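/- Let N ≥ 1 and let A be Haar-distributed on SO(2N+1). Define, for integers a, b, c, ε(a) = 1 if a is odd and 1 ≤ a ≤ 2N−1 (and 0 otherwise), α(a,b,c) = (min{a,N} + min{b,N} − c)⁺, and x⁺ = max{x,0}. Then Var( Σ_{k≥1} (Tr(A^k) − 1)²/k² ) = Σ_{k≥1} T(k)/k⁴ + Σ_{k,ℓ≥1, k≠ℓ} (V(k,ℓ) + δ(k,ℓ))/(k²ℓ²), where T(k) = 2·min{k², (2N)²} + 4ε(k)·min{k, 2N} + 6(min{k, N} − min{k, 2N}) + 4(ε(3k) − ε(k)); V(k,ℓ) = 8(N − max{k,ℓ})⁺ − 2(2N − |k−ℓ|)⁺ − 2(2N − k − ℓ)⁺ + 4α(min{k,ℓ}, max{k,ℓ}, max{k,ℓ}) + 4α(ℓ, ℓ−k, ℓ) + 4α(k, k−ℓ, k) + 4α(k+ℓ, ℓ, k+ℓ) + 4α(k+ℓ, k, k+ℓ) − 8α(k+ℓ, min{k,ℓ}, k+ℓ) − 4α(k, k, k+ℓ) − 4α(ℓ, ℓ, k+ℓ); and δ(k,ℓ) = 2(ε(ℓ)ε(|2k−ℓ|)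 − ε(2k+ℓ)) + 2(ε(k)ε(|2ℓ−k|) − ε(2ℓ+k)) + 2(ε(|k−ℓ|) − ε(k+ℓ)) + 4ε(ℓ)ε(|2k−ℓ|) + 4ε(2k+ℓ) + 4ε(k)ε(|2ℓ−k|) + 4ε(2ℓ+k) − 8ε(2·max{k,ℓ} − min{k,ℓ}) − 8ε(max{k,ℓ}). -/

import Mathlib

open MeasureTheory ProbabilityTheory Matrix

noncomputable section

instance matrixMeasurableSpace {m n α : Type*} [MeasurableSpace α] :
    MeasurableSpace (Matrix m n α) :=
  show MeasurableSpace (m → n → α) from inferInstance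

/-- `ε(a) = 1` if `a` is odd and `1 ≤ a ≤ 2N−1`, and `ε(a) = 0` otherwise. -/
def eps (N : ℕ) (a : ℤ) : ℝ :=
  if Odd a ∧ 1 ≤ a ∧ a ≤ 2 * (N : ℤ) - 1 then 1 else 0

/-- `α(a,b,c) = (min{a,N} + min{b,N} − c)⁺`. -/
def alph (N : ℕ) (a b c : ℤ) : ℝ :=
  ((max (min a (N : ℤ) + min b (N : ℤ) - c) 0 : ℤ) : ℝ)

/-- `T(k) = 2·min{k², (2N)²} + 4ε(k)·min{k, 2N} + 6(min{k, N} − min{k, 2N})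
    + 4(ε(3k) − ε(k))`. -/
def T (N : ℕ) (k : ℤ) : ℝ :=
  2 * min ((k : ℝ) ^ 2) ((2 * (N : ℝ)) ^ 2) + 4 * eps N k * min (k : ℝ) (2 * (N : ℝ))
    + 6 * (min (k : ℝ) (N : ℝ) - min (k : ℝ) (2 * (N : ℝ))) + 4 * (eps N (3 * k) - eps N k)

/-- The quantity `V(k,ℓ)` from Theorem 3 (ii) for `SO(2N+1)`. -/
def V (N : ℕ) (k l : ℤ) : ℝ :=
  8 * max ((N : ℝ) - max (k : ℝ) (l : ℝ)) 0 - 2 * max (2 * (N : ℝ) - |(k : ℝ) - (l : ℝ)|) 0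
    - 2 * max (2 * (N : ℝ) - (k : ℝ) - (l : ℝ)) 0
    + 4 * alph N (min k l) (max k l) (max k l) + 4 * alph N l (l - k) l + 4 * alph N k (k - l) k
    + 4 * alph N (k + l) l (k + l) + 4 * alph N (k + l) k (k + l)
    - 8 * alph N (k + l) (min k l) (k + l)
    - 4 * alph N k k (k + l) - 4 * alph N l l (k + l)

/-- The quantity `δ(k,ℓ)` from Theorem 3 (ii) for `SO(2N+1)`. -/
def delta (N : ℕ) (k l : ℤ) : ℝ :=
  2 * (eps N l * eps N |2 * k - l| - eps N (2 * k + l))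
    + 2 * (eps N k * eps N |2 * l - k| - eps N (2 * l + k))
    + 2 * (eps N |k - l| - eps N (k + l))
    + 4 * eps N l * eps N |2 * k - l| + 4 * eps N (2 * k + l)
    + 4 * eps N k * eps N |2 * l - k| + 4 * eps N (2 * l + k)
    - 8 * eps N (2 * max k l - min k l) - 8 * eps N (max k l)

namespace OddOrthogonal

/-- Laurent polynomials in `N` variables with complex coefficients. -/
abbrev Laurent (N : ℕ) := AddMonoidAlgebra ℂ (Fin N → ℤ)

section Laurent

variable {N : ℕ}

/-- The monomial `wᵢ ^ a`. -/
def w (i : Fin N) (a : ℤ) : Laurent N := AddMonoidAlgebra.single (Pi.single i a) 1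

lemma w_mul (i : Fin N) (a b : ℤ) : w i a * w i b = w i (a + b) := by
  simp [w, AddMonoidAlgebra.single_mul_single, Pi.single_add]

lemma w_zero (i : Fin N) : w i 0 = 1 := by
  simp [w, AddMonoidAlgebra.one_def]

/-- `zᵢ ^ k + zᵢ ^ (-k)` where `zᵢ = wᵢ ^ 2`. -/
def c (i : Fin N) (k : ℤ) : Laurent N := w i (2 * k) + w i (-(2 * k))

/-- `zᵢ ^ k - zᵢ ^ (-k)` where `zᵢ = wᵢ ^ 2`. -/
def s (i : Fin N) (k : ℤ) : Laurent N := w i (2 * k) - w i (-(2 * k))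

/-- `wᵢ ^ a - wᵢ ^ (-a)`. -/
def odd (i : Fin N) (a : ℤ) : Laurent N := w i a - w i (-a)

lemma c_zero (i : Fin N) : c i 0 = 2 := by
  simp [c, w_zero]; norm_num

lemma c_neg (i : Fin N) (k : ℤ) : c i (-k) = c i k := by
  simp [c, add_comm]

lemma c_mul_c (i : Fin N) (k l : ℤ) : c i k * c i l = c i (k + l) + c i (k - l) := by
  simp only [c, add_mul, mul_add, w_mul]
  ring_nf

lemma c_mul_odd (i : Fin N) (k a : ℤ) :
    c i k * odd i a = odd i (a + 2 * k) + odd i (a - 2 * k) := by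
  simp only [c, odd, add_mul, mul_sub, w_mul]
  ring_nf

/-- The linear map multiplying each coefficient by a function of its exponent. -/
def diag (g : (Fin N → ℤ) → ℂ) : Laurent N →ₗ[ℂ] Laurent N where
  toFun f := AddMonoidAlgebra.ofCoeff
    (Finsupp.onFinset f.coeff.support (fun μ => g μ * f.coeff μ) (by
      intro μ hμ
      simpa using right_ne_zero_of_mul hμ))
  map_add' f f' := by
    ext μ
    simp [mul_add]
  map_smul' r f := by
    ext μ
    simp [mul_left_comm]

@[simp] lemma diag_coeff (g : (Fin N → ℤ) → ℂ) (f : Laurent N) (μ : Fin N → ℤ) :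
    (diag g f).coeff μ = g μ * f.coeff μ := rfl

@[simp] lemma diag_single (g : (Fin N → ℤ) → ℂ) (μ : Fin N → ℤ) (r : ℂ) :
    diag g (AddMonoidAlgebra.single μ r) = AddMonoidAlgebra.single μ (g μ * r) := by
  ext ν
  by_cases h : μ = ν
  · subst h; simp
  · simp [h]

/-- The derivation `wᵢ ∂/∂wᵢ`. -/
def D (i : Fin N) : Laurent N →ₗ[ℂ] Laurent N := diag fun μ => (μ i : ℂ)

/-- The sum of the squares of the derivations `wᵢ ∂/∂wᵢ`. -/
def H : Laurent N →ₗ[ℂ] Laurent N := diag fun μ => ∑ i, (μ i : ℂ) ^ 2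

lemma D_mul (i : Fin N) (f g : Laurent N) : D i (f * g) = D i f * g + f * D i g := by
  induction f using AddMonoidAlgebra.induction_linear with
  | zero => simp
  | add f f' h h' => simp only [add_mul, map_add, h, h']; ring
  | single μ r =>
    induction g using AddMonoidAlgebra.induction_linear with
    | zero => simp
    | add f f' h h' => simp only [mul_add, map_add, h, h']; ring
    | single ν t =>
      simp only [D, AddMonoidAlgebra.single_mul_single, diag_single, ← AddMonoidAlgebra.single_add]
      congr 1
      push_cast [Pi.add_apply]
      ring

lemma D_one (i : Fin N) : D i 1 = 0 := by
  simp [D, AddMonoidAlgebra.one_def]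

lemma D_algebraMap (i : Fin N) (r : ℂ) : D i (algebraMap ℂ _ r) = 0 := by
  rw [Algebra.algebraMap_eq_smul_one, map_smul, D_one, smul_zero]

lemma H_eq (f : Laurent N) : H f = ∑ i, D i (D i f) := by
  ext μ
  simp [H, D, Finset.sum_mul, sq, mul_assoc, Finsupp.finsetSum_apply]

lemma D_w (i j : Fin N) (a : ℤ) : D i (w j a) = if i = j then (a : ℂ) • w j a else 0 := by
  simp only [D, w, diag_single]
  split_ifs with h
  · subst h; simp
  · simp [h]

lemma D_c (i j : Fin N) (k : ℤ) : D i (c j k) = if i = j then (2 * k : ℂ) • s j k else 0 := by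
  simp only [c, s, map_add, D_w]
  split_ifs
  · push_cast; module
  · simp

lemma D_odd (i j : Fin N) (a : ℤ) :
    D i (odd j a) = if i = j then (a : ℂ) • (w j a + w j (-a)) else 0 := by
  simp only [odd, map_sub, D_w]
  split_ifs
  · push_cast; module
  · simp

/-- The power sum `1 + ∑ᵢ (zᵢ ^ k + zᵢ ^ (-k))`. -/
def p (k : ℤ) : Laurent N := 1 + ∑ i, c i k

/-- The derivation `∑ᵢ (zᵢ ^ k - zᵢ ^ (-k)) wᵢ ∂/∂wᵢ`. -/
def E (k : ℤ) (f : Laurent N) : Laurent N := ∑ i, s i k * D i f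

lemma D_p (i : Fin N) (k : ℤ) : D i (p k) = (2 * k : ℂ) • s i k := by
  simp [p, D_one, D_c]

lemma E_mul (k : ℤ) (f g : Laurent N) : E k (f * g) = E k f * g + f * E k g := by
  simp only [E, D_mul, Finset.sum_mul, Finset.mul_sum, ← Finset.sum_add_distrib]
  exact Finset.sum_congr rfl fun i _ => by ring

lemma E_prod {ι : Type*} (k : ℤ) (t : Finset ι) (f u : ι → Laurent N)
    (h : ∀ i ∈ t, E k (f i) = f i * u i) :
    E k (∏ i ∈ t, f i) = (∏ i ∈ t, f i) * ∑ i ∈ t, u i := by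
  classical
  induction t using Finset.induction_on with
  | empty => simp [E, D_one]
  | insert a t ha ih =>
    rw [Finset.prod_insert ha, Finset.sum_insert ha, E_mul, h a (by simp),
      ih fun i hi => h i (by simp [hi])]
    ring

/-- The Weyl denominator of `SO(2N+1)`. -/
def δ : Laurent N := (Matrix.of fun i j : Fin N => odd i (2 * (j : ℤ) + 1)).det

/-- Polynomials `q` with `w ^ (2j+1) - w ^ (-(2j+1)) = (w - w⁻¹) q (w ^ 2 + w ^ (-2))`. -/
def q (R : Type*) [CommRing R] : ℕ → Polynomial R
  | 0 => 1
  | 1 => Polynomial.X + 1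
  | (n + 2) => Polynomial.X * q R (n + 1) - q R n

lemma q_monic (R : Type*) [CommRing R] [Nontrivial R] (n : ℕ) :
    (q R n).Monic ∧ (q R n).natDegree = n := by
  induction n using Nat.twoStepInduction with
  | zero => simp [q]
  | one =>
    refine ⟨?_, ?_⟩
    · simpa [q] using Polynomial.monic_X_add_C (1 : R)
    · simpa [q] using Polynomial.natDegree_X_add_C (1 : R)
  | more n h1 h2 =>
    have hm : (Polynomial.X * q R (n + 1)).Monic := Polynomial.monic_X.mul h2.1
    have hd : (Polynomial.X * q R (n + 1)).natDegree = n + 2 := by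
      rw [Polynomial.monic_X.natDegree_mul h2.1, h2.2, Polynomial.natDegree_X]; ring
    have hlt : (q R n).degree < (Polynomial.X * q R (n + 1)).degree := by
      apply Polynomial.degree_lt_degree
      rw [hd, h1.2]; omega
    refine ⟨hm.sub_of_left hlt, ?_⟩
    rw [q, Polynomial.natDegree_sub_eq_left_of_natDegree_lt, hd]
    rw [hd, h1.2]; omega

lemma odd_eq (i : Fin N) (n : ℕ) :
    odd i (2 * (n : ℤ) + 1) = odd i 1 * (q (Laurent N) n).eval (c i 1) := by
  induction n using Nat.twoStepInduction with
  | zero => simp [q]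
  | one =>
    simp only [q, Polynomial.eval_add, Polynomial.eval_X, Polynomial.eval_one, mul_add]
    rw [mul_comm (odd i 1) (c i 1), c_mul_odd]
    norm_num
    simp only [odd]
    simp
    ring
  | more n h1 h2 =>
    simp only [q, Polynomial.eval_sub, Polynomial.eval_mul, Polynomial.eval_X, mul_sub, ← h1]
    rw [mul_left_comm, ← h2, c_mul_odd]
    push_cast
    ring_nf

lemma δ_eq : (δ : Laurent N) =
    (∏ i, odd i 1) * ∏ i : Fin N, ∏ j ∈ Finset.Ioi i, (c j 1 - c i 1) := by
  rw [← Matrix.det_vandermonde, Matrix.det_eval_matrixOfPolynomials_eq_det_vandermonde _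
    (fun j : Fin N => q (Laurent N) j) (fun j => (q_monic _ _).2) (fun j => (q_monic _ _).1),
    ← Matrix.det_mul_column]
  refine congrArg Matrix.det (Matrix.ext fun i j => ?_)
  simp [odd_eq]

lemma E_odd (i : Fin N) (k : ℕ) :
    E k (odd i 1) = odd i 1 * ∑ j ∈ Finset.range k, (c i j + c i (k - j)) := by
  have h1 : ∀ n : ℕ, (∑ j ∈ Finset.range n, c i j) * odd i 1 = odd i (2 * n - 1) + odd i 1 := by
    intro n
    induction n with
    | zero => simp [odd]
    | succ n ih =>
      rw [Finset.sum_range_succ, add_mul, ih, c_mul_odd]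
      simp only [odd]; push_cast; ring_nf
  have h2 : ∑ j ∈ Finset.range k, c i (k - j) = ∑ j ∈ Finset.range (k + 1), c i j - c i 0 := by
    rw [Finset.sum_range_succ', ← Finset.sum_range_reflect]
    simp only [Nat.cast_zero, add_sub_cancel_right]
    refine Finset.sum_congr rfl fun j hj => ?_
    rw [Finset.mem_range] at hj
    congr 1
    omega
  rw [Finset.sum_add_distrib, h2, mul_comm, add_mul, sub_mul, h1, h1, c_mul_odd]
  simp only [E, D_odd, mul_ite, mul_zero, Finset.sum_ite_eq', Finset.mem_univ, if_true,
    Int.cast_one, one_smul]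
  simp only [odd, s, sub_mul, mul_add, w_mul]
  push_cast
  ring_nf

lemma s_mul_s (i : Fin N) (k l : ℤ) : s i k * s i l = c i (k + l) - c i (k - l) := by
  simp only [c, s, sub_mul, mul_sub, w_mul]
  ring_nf

lemma E_c_sub_c (a b : Fin N) (k : ℕ) :
    E k (c b 1 - c a 1) = (c b 1 - c a 1) *
      ∑ j ∈ Finset.range k, (c a j * c b (k - j) + c b j * c a (k - j)) := by
  have key : ∀ a b : Fin N, (c b 1 - c a 1) * ∑ j ∈ Finset.range k, c a j * c b (k - j)
      = c a 0 * c b (k + 1) - c a k * c b 1 + (c a (k - 1) * c b 0 - c a (-1) * c b k) := by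
    intro a b
    have h1 := Finset.sum_range_sub (fun j : ℕ => c a j * c b (k + 1 - j)) k
    have h2 := Finset.sum_range_sub (fun j : ℕ => c a (j - 1) * c b (k - j)) k
    simp only [Nat.cast_zero, sub_zero, zero_sub, sub_self] at h1 h2
    rw [add_sub_cancel_left] at h1
    have h3 : (c b 1 - c a 1) * ∑ j ∈ Finset.range k, c a j * c b (k - j)
        = (c a (k - 1) * c b 0 - c a (-1) * c b k) - (c a k * c b 1 - c a 0 * c b (k + 1)) := by
      rw [← h1, ← h2, ← Finset.sum_sub_distrib, Finset.mul_sum]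
      refine Finset.sum_congr rfl fun j _ => ?_
      have e1 : c b 1 * c b (k - j) = c b (k + 1 - j) + c b (k - (j + 1)) := by
        rw [mul_comm, c_mul_c]; ring_nf
      have e2 : c a 1 * c a j = c a (j + 1) + c a (j - 1) := by
        rw [mul_comm, c_mul_c]
      push_cast
      rw [add_sub_cancel_right, show (k : ℤ) + 1 - (j + 1) = k - j by ring]
      linear_combination c a j * e1 - c b (k - j) * e2
    rw [h3]; ring
  have hE : E k (c b 1 - c a 1)
      = 2 * (c b (k + 1) - c b (k - 1)) - 2 * (c a (k + 1) - c a (k - 1)) := by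
    have : ∀ b : Fin N, E k (c b 1) = 2 * (c b (k + 1) - c b (k - 1)) := by
      intro b
      simp only [E, D_c, mul_ite, mul_zero, Finset.sum_ite_eq', Finset.mem_univ, if_true]
      rw [← s_mul_s, Int.cast_one, mul_one, mul_smul_comm, two_smul, two_mul]
    rw [← this, ← this]
    simp [E, mul_sub]
  rw [hE, Finset.sum_add_distrib, mul_add, key a b]
  have := key b a
  rw [c_zero, c_zero, c_neg] at *
  linear_combination this

lemma sum_sum_eq_diag_add_Ioi {M : Type*} [AddCommMonoid M] (f : Fin N → Fin N → M) :
    ∑ a, ∑ b, f a b = ∑ a, f a a + ∑ a, ∑ b ∈ Finset.Ioi a, (f a b + f b a) := by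
  have h := Finset.sum_sum_Ioi_add_eq_sum_sum_off_diag (fun a b => f b a)
  rw [h, ← Finset.sum_add_distrib]
  refine Finset.sum_congr rfl fun a _ => ?_
  rw [Fintype.sum_eq_add_sum_compl a]

/-- The quadratic expression in power sums which describes the logarithmic derivative
of the Weyl denominator along `E k`. -/
def Q (N k : ℕ) : Laurent N :=
  ∑ j ∈ Finset.range k, (p j * p (k - j) - p (k - 2 * j)) - (k : ℂ) • (p k - 1)

lemma E_δ (k : ℕ) : E k (δ : Laurent N) = δ * Q N k := by
  rw [δ_eq, E_mul, E_prod k _ _ _ fun i _ => E_odd i k,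
    E_prod k Finset.univ _ _ fun i _ => E_prod k _ _ _ fun j _ => E_c_sub_c i j k]
  have hQ : Q N k = ∑ i : Fin N, ∑ j ∈ Finset.range k, (c i j + c i (k - j))
      + ∑ a : Fin N, ∑ b ∈ Finset.Ioi a,
        ∑ j ∈ Finset.range k, (c a j * c b (k - j) + c b j * c a (k - j)) := by
    have h1 : ∀ j : ℕ, (p j * p (k - j) - p (k - 2 * j) : Laurent N)
        = ∑ i : Fin N, (c i j + c i (k - j)) + ∑ i : Fin N, c i k
          + ∑ a : Fin N, ∑ b ∈ Finset.Ioi a, (c a j * c b (k - j) + c b j * c a (k - j)) := by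
      intro j
      have h := sum_sum_eq_diag_add_Ioi (fun a b : Fin N => c a j * c b (k - j))
      have h2 : ∑ a : Fin N, c a j * c a (k - j) = ∑ a : Fin N, c a k
          + ∑ a : Fin N, c a (k - 2 * j) := by
        rw [← Finset.sum_add_distrib]
        refine Finset.sum_congr rfl fun a _ => ?_
        rw [mul_comm, c_mul_c]
        ring_nf
      rw [← Finset.sum_mul_sum, h2] at h
      rw [Finset.sum_add_distrib]
      simp only [p]
      linear_combination h
    have h4 : ((k : ℂ) • (p k - 1) : Laurent N) = k • ∑ i : Fin N, c i k := by
      simp only [p, add_sub_cancel_left]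
      exact Nat.cast_smul_eq_nsmul ..
    have h5 : ∑ j ∈ Finset.range k, ∑ a : Fin N, ∑ b ∈ Finset.Ioi a,
          (c a j * c b (k - j) + c b j * c a (k - j))
        = ∑ a : Fin N, ∑ b ∈ Finset.Ioi a,
          ∑ j ∈ Finset.range k, (c a j * c b (k - j) + c b j * c a (k - j)) := by
      rw [Finset.sum_comm]
      exact Finset.sum_congr rfl fun a _ => Finset.sum_comm
    rw [Q, h4, Finset.sum_congr rfl fun j _ => h1 j, Finset.sum_add_distrib,
      Finset.sum_add_distrib, Finset.sum_const, Finset.card_range, h5, Finset.sum_comm]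
    abel
  rw [hQ]
  ring

/-- The square of the Weyl vector in doubled coordinates. -/
def ρsq (N : ℕ) : ℤ := ∑ j : Fin N, (2 * (j : ℤ) + 1) ^ 2

lemma D_prod_eq_zero (i : Fin N) (a : Fin N → ℤ) (t : Finset (Fin N)) (hi : i ∉ t) :
    D i (∏ j ∈ t, odd j (a j)) = 0 := by
  induction t using Finset.induction_on with
  | empty => simp [D_one]
  | insert b t hb ih =>
    simp only [Finset.mem_insert, not_or] at hi
    rw [Finset.prod_insert hb, D_mul, ih hi.2, D_odd, if_neg hi.1]
    simp

lemma H_prod_odd (a : Fin N → ℤ) :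
    H (∏ i, odd i (a i)) = ((∑ i, a i ^ 2 : ℤ) : ℂ) • ∏ i, odd i (a i) := by
  rw [H_eq, Int.cast_sum, Finset.sum_smul]
  refine Finset.sum_congr rfl fun i _ => ?_
  rw [← Finset.mul_prod_erase _ _ (Finset.mem_univ i), D_mul, D_prod_eq_zero _ _ _ (by simp),
    mul_zero, add_zero, D_mul, D_prod_eq_zero _ _ _ (by simp), mul_zero, add_zero, D_odd,
    if_pos rfl,
    map_smul, map_add, D_w, D_w, if_pos rfl, if_pos rfl, ← smul_mul_assoc]
  congr 1
  simp only [odd]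
  push_cast
  module

lemma δ_eq_sum : (δ : Laurent N) = ∑ σ : Equiv.Perm (Fin N), (Equiv.Perm.sign σ : ℤ) •
    ∏ i, odd i (2 * (σ i : ℤ) + 1) := by
  rw [δ, ← Matrix.det_transpose, Matrix.det_apply]
  rfl

lemma H_δ : H (δ : Laurent N) = (ρsq N : ℂ) • δ := by
  rw [δ_eq_sum, map_sum, Finset.smul_sum]
  refine Finset.sum_congr rfl fun σ _ => ?_
  rw [map_zsmul, H_prod_odd, smul_comm]
  rw [ρsq, ← Equiv.sum_comp σ fun j : Fin N => (2 * (j : ℤ) + 1) ^ 2]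

/-- The algebra generated by the power sums. -/
def B (N : ℕ) : Subalgebra ℂ (Laurent N) := Algebra.adjoin ℂ (Set.range fun k : ℕ => p k)

lemma p_mem_B (k : ℤ) : (p k : Laurent N) ∈ B N := by
  obtain ⟨n, rfl | rfl⟩ := k.eq_nat_or_neg
  · exact Algebra.subset_adjoin ⟨n, rfl⟩
  · have : (p (-(n : ℤ)) : Laurent N) = p n := by simp [p, c_neg]
    rw [this]
    exact Algebra.subset_adjoin ⟨n, rfl⟩

/-- The quadratic part of the loop equations. -/
def S (N k : ℕ) : Laurent N := ∑ j ∈ Finset.range k, (p j * p (k - j) - p (k - 2 * j))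

/-- A bidifferential operator; at `h = 1` it is the action on `f` of the Laplacian conjugated
by the Weyl denominator. -/
def J (f h : Laurent N) : Laurent N := ∑ a, (D a (δ * D a f * h) + D a δ * D a f * h)

lemma J_mul (f g h : Laurent N) : J (f * g) h = J f (g * h) + J g (f * h) := by
  simp only [J, ← Finset.sum_add_distrib, D_mul, map_add]
  exact Finset.sum_congr rfl fun a _ => by ring

lemma J_add (f g h : Laurent N) : J (f + g) h = J f h + J g h := by
  simp only [J, ← Finset.sum_add_distrib, map_add]
  refine Finset.sum_congr rfl fun a _ => ?_
  rw [mul_add, add_mul, map_add]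
  ring

lemma J_algebraMap (r : ℂ) (h : Laurent N) : J (algebraMap ℂ _ r) h = 0 := by
  simp only [J, D_algebraMap, mul_zero, zero_mul, map_zero, add_zero, Finset.sum_const_zero]

lemma J_one (f : Laurent N) : J f 1 = H (δ * f) - (ρsq N : ℂ) • (δ * f) := by
  rw [← smul_mul_assoc, ← H_δ, H_eq, H_eq, Finset.sum_mul, ← Finset.sum_sub_distrib]
  refine Finset.sum_congr rfl fun a _ => ?_
  simp only [mul_one, D_mul, map_add]
  ring

lemma D_s (i : Fin N) (k : ℤ) : D i (s i k) = (2 * k : ℂ) • c i k := by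
  simp only [c, s, map_sub, D_w, if_pos]
  push_cast; module

lemma J_p (k : ℕ) (h : Laurent N) :
    J (p k) h = δ * ((2 * k : ℂ) • (2 * (h * S N k) + E k h)) := by
  have h1 : J (p k) h = (2 * k : ℂ) • (2 * (h * E k δ) + δ * E k h
      + (2 * k : ℂ) • (δ * h * (p k - 1))) := by
    simp only [J, E, p, add_sub_cancel_left, Finset.mul_sum, Finset.smul_sum,
      ← Finset.sum_add_distrib]
    refine Finset.sum_congr rfl fun a _ => ?_
    have := D_p a k
    rw [p] at this
    rw [this]
    simp only [mul_smul_comm, smul_mul_assoc, map_smul, D_mul, D_s, Int.cast_natCast, smul_add]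
    simp only [Algebra.smul_def, map_mul, map_ofNat]
    ring
  have h3 : Q N k = S N k - (k : ℂ) • (p k - 1) := rfl
  rw [h1, E_δ, h3, mul_smul_comm]
  congr 1
  simp only [Algebra.smul_def, map_mul, map_ofNat]
  ring

lemma exists_J_eq (K : Submodule ℂ (Laurent N))
    (hK : ∀ h ∈ B N, ∀ k : ℕ, 2 * (h * S N k) + E k h ∈ K) (f : Laurent N) (hf : f ∈ B N) :
    ∀ h ∈ B N, ∃ g ∈ K, J f h = δ * g := by
  induction hf using Algebra.adjoin_induction with
  | mem x hx =>
    obtain ⟨k, rfl⟩ := hx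
    exact fun h hh => ⟨_, K.smul_mem _ (hK h hh k), J_p k h⟩
  | algebraMap r => exact fun h _ => ⟨0, K.zero_mem, by rw [J_algebraMap, mul_zero]⟩
  | add x y _ _ ihx ihy =>
    intro h hh
    obtain ⟨g, hg, hg'⟩ := ihx h hh
    obtain ⟨g', hgk, hgk'⟩ := ihy h hh
    exact ⟨g + g', K.add_mem hg hgk, by rw [J_add, hg', hgk', mul_add]⟩
  | mul x y hx hy ihx ihy =>
    intro h hh
    obtain ⟨g, hg, hg'⟩ := ihx (y * h) (mul_mem hy hh)
    obtain ⟨g', hgk, hgk'⟩ := ihy (x * h) (mul_mem hx hh)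
    exact ⟨g + g', K.add_mem hg hgk, by rw [J_mul, hg', hgk', mul_add]⟩

/-- The embedding of one-variable Laurent polynomials in the variable `wᵢ`. -/
def ι (i : Fin N) : AddMonoidAlgebra ℂ ℤ →ₐ[ℂ] Laurent N :=
  AddMonoidAlgebra.mapDomainAlgHom ℂ ℂ (AddMonoidHom.single (fun _ : Fin N => ℤ) i)

lemma ι_single (i : Fin N) (a : ℤ) (r : ℂ) :
    ι i (AddMonoidAlgebra.single a r) = AddMonoidAlgebra.single (Pi.single i a) r := by
  exact AddMonoidAlgebra.mapDomain_single

lemma coeff_prod_ι (g : Fin N → AddMonoidAlgebra ℂ ℤ) (μ : Fin N → ℤ) :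
    (∏ i, ι i (g i)).coeff μ = ∏ i, (g i).coeff (μ i) := by
  have key : ∀ (t : Finset (Fin N)) (μ : Fin N → ℤ), (∏ i ∈ t, ι i (g i)).coeff μ
      = if ∀ i ∉ t, μ i = 0 then ∏ i ∈ t, (g i).coeff (μ i) else 0 := by
    intro t
    induction t using Finset.induction_on with
    | empty =>
      intro μ
      simp only [Finset.prod_empty, Finset.notMem_empty, not_false_eq_true, forall_const]
      by_cases h : μ = 0
      · subst h; simp [AddMonoidAlgebra.one_def]
      · rw [if_neg (fun hh : ∀ i, μ i = 0 => h (funext hh))]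
        simp [AddMonoidAlgebra.one_def, Ne.symm h]
    | insert a t ha ih =>
      intro μ
      rw [Finset.prod_insert ha]
      have hg : ∀ u : AddMonoidAlgebra ℂ ℤ, (ι a u * ∏ i ∈ t, ι i (g i)).coeff μ
          = if ∀ i ∉ insert a t, μ i = 0 then u.coeff (μ a) * ∏ i ∈ t, (g i).coeff (μ i)
            else 0 := by
        intro u
        induction u using AddMonoidAlgebra.induction_linear with
        | zero => simp
        | add u v hu hv =>
          rw [map_add, add_mul, AddMonoidAlgebra.coeff_add, Finsupp.add_apply, hu, hv]
          split_ifs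
          · simp [add_mul]
          · simp
        | single n r =>
          rw [ι_single]
          have h1 : (AddMonoidAlgebra.single (Pi.single a n) r * ∏ i ∈ t, ι i (g i)).coeff μ
              = r * (∏ i ∈ t, ι i (g i)).coeff (μ - Pi.single a n) := by
            have := AddMonoidAlgebra.coeff_single_mul_apply (∏ i ∈ t, ι i (g i)) r (Pi.single a n) μ
            rw [this]
            congr 2
            abel
          rw [h1, ih]
          have h2 : ∏ i ∈ t, (g i).coeff ((μ - Pi.single a n : Fin N → ℤ) i)
              = ∏ i ∈ t, (g i).coeff (μ i) := by
            refine Finset.prod_congr rfl fun i hi => ?_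
            rw [Pi.sub_apply, Pi.single_eq_of_ne (by rintro rfl; exact ha hi), sub_zero]
          rw [h2]
          by_cases hn : μ a = n
          · have h3 : (∀ i ∉ t, (μ - Pi.single a n : Fin N → ℤ) i = 0)
                ↔ ∀ i ∉ insert a t, μ i = 0 := by
              constructor
              · intro h i hi
                rw [Finset.mem_insert, not_or] at hi
                have := h i hi.2
                rwa [Pi.sub_apply, Pi.single_eq_of_ne hi.1, sub_zero] at this
              · intro h i hi
                by_cases hia : i = a
                · subst hia; simp [hn]
                · rw [Pi.sub_apply, Pi.single_eq_of_ne hia, sub_zero]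
                  exact h i (by simp [hia, hi])
            simp only [h3, mul_ite, mul_zero, hn, AddMonoidAlgebra.coeff_single,
              Finsupp.single_eq_same]
          · rw [if_neg]
            · rw [AddMonoidAlgebra.coeff_single, Finsupp.single_eq_of_ne hn, zero_mul, mul_zero,
                ite_self]
            · intro h
              have := h a ha
              simp only [Pi.sub_apply, Pi.single_eq_same] at this
              omega
      rw [hg]
      split_ifs
      · rw [Finset.prod_insert ha]
      · rfl
  rw [key, if_pos (by simp)]

/-- The one-variable Laurent polynomial `w ^ a - w ^ (-a)`. -/
def φ (a : ℤ) : AddMonoidAlgebra ℂ ℤ :=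
  AddMonoidAlgebra.single a 1 - AddMonoidAlgebra.single (-a) 1

lemma ι_φ (i : Fin N) (a : ℤ) : ι i (φ a) = odd i a := by
  simp only [φ, odd, w, map_sub, ι_single]

/-- The Weyl vector in doubled coordinates. -/
def ρ (N : ℕ) (i : Fin N) : ℤ := 2 * (i : ℤ) + 1

lemma coeff_δ_mul (g : Fin N → AddMonoidAlgebra ℂ ℤ) :
    (δ * ∏ i, ι i (g i) : Laurent N).coeff (ρ N)
      = (Matrix.of fun i j : Fin N => (g i * φ (2 * (j : ℤ) + 1)).coeff (2 * (i : ℤ) + 1)).det := by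
  rw [δ_eq_sum, Finset.sum_mul, AddMonoidAlgebra.coeff_sum, Finsupp.finsetSum_apply,
    ← Matrix.det_transpose, Matrix.det_apply]
  refine Finset.sum_congr rfl fun σ _ => ?_
  rw [smul_mul_assoc, ← Finset.prod_mul_distrib]
  have : ∏ i, odd i (2 * (σ i : ℤ) + 1) * ι i (g i)
      = ∏ i, ι i (g i * φ (2 * (σ i : ℤ) + 1)) :=
    Finset.prod_congr rfl fun i _ => by rw [map_mul, ι_φ, mul_comm]
  rw [this, AddMonoidAlgebra.coeff_smul, Finsupp.smul_apply, coeff_prod_ι]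
  rfl

lemma coeff_δ : (δ : Laurent N).coeff (ρ N) = 1 := by
  have := coeff_δ_mul (N := N) fun _ => 1
  simp only [map_one, Finset.prod_const_one, mul_one, one_mul] at this
  refine this.trans ((congrArg Matrix.det (Matrix.ext fun i j => ?_)).trans
    (Matrix.det_one (n := Fin N) (R := ℂ)))
  simp only [φ, Matrix.of_apply, Matrix.one_apply, AddMonoidAlgebra.coeff_sub,
    Finsupp.sub_apply, AddMonoidAlgebra.coeff_single, Finsupp.single_apply, Fin.ext_iff]
  split_ifs <;> first | omega | simp

/-- Laurent polynomials with odd exponents which are antisymmetric under the signed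
permutations of the variables. -/
def Anti (N : ℕ) : Submodule ℂ (Laurent N) where
  carrier := {u | (∀ (σ : Equiv.Perm (Fin N)) (μ : Fin N → ℤ),
      u.coeff (μ ∘ σ) = ((Equiv.Perm.sign σ : ℤ) : ℂ) * u.coeff μ) ∧
    (∀ (i : Fin N) (μ : Fin N → ℤ), u.coeff (Function.update μ i (-μ i)) = -u.coeff μ) ∧
    ∀ (i : Fin N) (μ : Fin N → ℤ), ¬ Odd (μ i) → u.coeff μ = 0}
  add_mem' := by
    rintro u v ⟨h1, h2, h3⟩ ⟨h4, h5, h6⟩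
    refine ⟨fun σ μ => ?_, fun i μ => ?_, fun i μ h => ?_⟩ <;>
      rw [AddMonoidAlgebra.coeff_add, Finsupp.add_apply]
    · rw [Finsupp.add_apply, h1, h4, mul_add]
    · rw [Finsupp.add_apply, h2, h5, neg_add]
    · rw [h3 i μ h, h6 i μ h, add_zero]
  zero_mem' := by simp
  smul_mem' := by
    rintro r u ⟨h1, h2, h3⟩
    refine ⟨fun σ μ => ?_, fun i μ => ?_, fun i μ h => ?_⟩ <;>
      rw [AddMonoidAlgebra.coeff_smul, Finsupp.smul_apply, smul_eq_mul]
    · rw [Finsupp.smul_apply, smul_eq_mul, h1, mul_left_comm]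
    · rw [Finsupp.smul_apply, smul_eq_mul, h2, mul_neg]
    · rw [h3 i μ h, mul_zero]

lemma coeff_w_mul (i : Fin N) (a : ℤ) (u : Laurent N) (μ : Fin N → ℤ) :
    (w i a * u).coeff μ = u.coeff (μ - Pi.single i a) := by
  have := AddMonoidAlgebra.coeff_single_mul_apply u 1 (Pi.single i a) μ
  rw [w, this, one_mul]
  congr 1
  abel

lemma coeff_p_mul (k : ℤ) (u : Laurent N) (μ : Fin N → ℤ) :
    (p k * u).coeff μ = u.coeff μ +
      ∑ i, (u.coeff (μ - Pi.single i (2 * k)) + u.coeff (μ + Pi.single i (2 * k))) := by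
  simp only [p, add_mul, one_mul, Finset.sum_mul, c, AddMonoidAlgebra.coeff_add,
    Finsupp.add_apply, AddMonoidAlgebra.coeff_sum, Finsupp.finsetSum_apply, coeff_w_mul,
    Pi.single_neg, sub_neg_eq_add]

lemma p_mul_mem_Anti (k : ℤ) (u : Laurent N) (hu : u ∈ Anti N) : p k * u ∈ Anti N := by
  obtain ⟨h1, h2, h3⟩ := hu
  refine ⟨fun σ μ => ?_, fun j μ => ?_, fun i μ h => ?_⟩
  · rw [coeff_p_mul, coeff_p_mul, mul_add, h1, Finset.mul_sum]
    congr 1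
    conv_rhs => rw [← Equiv.sum_comp σ]
    refine Finset.sum_congr rfl fun i _ => ?_
    rw [mul_add, ← h1, ← h1]
    have : ∀ a : ℤ, (Pi.single (σ i) a : Fin N → ℤ) ∘ σ = Pi.single i a := by
      intro a
      ext j
      simp [Pi.single_apply]
    have e1 : (μ - Pi.single (σ i) (2 * k)) ∘ σ = μ ∘ σ - Pi.single i (2 * k) := by
      rw [← this]; rfl
    have e2 : (μ + Pi.single (σ i) (2 * k)) ∘ σ = μ ∘ σ + Pi.single i (2 * k) := by
      rw [← this]; rfl
    rw [e1, e2]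
  · rw [coeff_p_mul, coeff_p_mul, neg_add, h2, ← Finset.sum_neg_distrib]
    congr 1
    refine Finset.sum_congr rfl fun i _ => ?_
    rw [neg_add, ← h2 j, ← h2 j]
    by_cases hij : i = j
    · subst hij
      rw [add_comm]
      congr 2 <;> ext l <;> by_cases hl : l = i
      all_goals first | (subst hl; simp; ring_nf) | simp [hl]
    · congr 2 <;> ext l <;> by_cases hl : l = j
      all_goals first
        | (subst hl; simp [Pi.single_eq_of_ne (Ne.symm hij)])
        | simp [hl]
  · rw [coeff_p_mul, h3 i μ h, zero_add]
    refine Finset.sum_eq_zero fun j _ => ?_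
    rw [h3 i, h3 i, add_zero]
    all_goals
      rw [Int.not_odd_iff_even] at h ⊢
      simp only [Pi.add_apply, Pi.sub_apply, Pi.single_apply]
      split_ifs
    · exact h.add (even_two_mul k)
    · simpa using h
    · exact h.sub (even_two_mul k)
    · simpa using h

lemma mul_mem_Anti (f : Laurent N) (hf : f ∈ B N) : ∀ u ∈ Anti N, f * u ∈ Anti N := by
  induction hf using Algebra.adjoin_induction with
  | mem x hx =>
    obtain ⟨k, rfl⟩ := hx
    exact p_mul_mem_Anti k
  | algebraMap r => exact fun u hu => by rw [← Algebra.smul_def]; exact (Anti N).smul_mem r hu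
  | add x y _ _ ihx ihy =>
    exact fun u hu => by rw [add_mul]; exact (Anti N).add_mem (ihx u hu) (ihy u hu)
  | mul x y _ _ ihx ihy => exact fun u hu => by rw [mul_assoc]; exact ihx _ (ihy u hu)

lemma coeff_φ (a m : ℤ) : (φ a).coeff m = (if m = a then 1 else 0) - if m = -a then 1 else 0 := by
  simp only [φ, AddMonoidAlgebra.coeff_sub, Finsupp.sub_apply, AddMonoidAlgebra.coeff_single,
    Finsupp.single_apply, eq_comm]

lemma coeff_φ_neg (a m : ℤ) : (φ a).coeff (-m) = -(φ a).coeff m := by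
  rw [coeff_φ, coeff_φ]
  simp only [neg_eq_iff_eq_neg, neg_neg]
  ring

lemma coeff_δ_eq (μ : Fin N → ℤ) :
    (δ : Laurent N).coeff μ
      = (Matrix.of fun i j : Fin N => (φ (2 * (j : ℤ) + 1)).coeff (μ i)).det := by
  rw [δ_eq_sum, AddMonoidAlgebra.coeff_sum, Finsupp.finsetSum_apply,
    ← Matrix.det_transpose, Matrix.det_apply]
  refine Finset.sum_congr rfl fun σ _ => ?_
  have : ∏ i, odd i (2 * (σ i : ℤ) + 1) = ∏ i, ι i (φ (2 * (σ i : ℤ) + 1)) :=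
    Finset.prod_congr rfl fun i _ => by rw [ι_φ]
  rw [this, AddMonoidAlgebra.coeff_smul, Finsupp.smul_apply, coeff_prod_ι]
  rfl

lemma δ_mem_Anti : (δ : Laurent N) ∈ Anti N := by
  refine ⟨fun σ μ => ?_, fun i μ => ?_, fun i μ h => ?_⟩
  · rw [coeff_δ_eq, coeff_δ_eq, ← Matrix.det_permute]
    rfl
  · rw [coeff_δ_eq, coeff_δ_eq]
    have := Matrix.det_updateRow_smul
      (Matrix.of fun i j : Fin N => (φ (2 * (j : ℤ) + 1)).coeff (μ i)) i (-1)
      (fun j : Fin N => (φ (2 * (j : ℤ) + 1)).coeff (μ i))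
    rw [neg_one_mul] at this
    rw [← Matrix.updateRow_eq_self
    (Matrix.of fun i j : Fin N => (φ (2 * (j : ℤ) + 1)).coeff (μ i)) i]
    refine Eq.trans (congrArg Matrix.det (Matrix.ext fun a b => ?_)) this
    by_cases ha : a = i
    · subst ha
      simp [coeff_φ_neg]
    · simp [ha]
  · rw [coeff_δ_eq]
    refine Matrix.det_eq_zero_of_row_eq_zero i fun j => ?_
    rw [Matrix.of_apply, coeff_φ, if_neg, if_neg, sub_zero]
    · rintro heq
      exact h ⟨-(j : ℤ) - 1, by rw [heq]; ring⟩
    · rintro heq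
      exact h ⟨j, by rw [heq]⟩

/-- The square of the Euclidean length of an exponent. -/
def nsq (μ : Fin N → ℤ) : ℤ := ∑ i, μ i ^ 2

lemma H_eq_diag : (H : Laurent N →ₗ[ℂ] Laurent N) = diag fun μ => (nsq μ : ℂ) := by
  simp [H, nsq]

lemma coeff_ne_zero_update {u : Laurent N} (hu : u ∈ Anti N) {μ : Fin N → ℤ}
    (h : u.coeff μ ≠ 0) : u.coeff (fun i => |μ i|) ≠ 0 := by
  have key : ∀ t : Finset (Fin N), u.coeff (fun i => if i ∈ t then |μ i| else μ i) ≠ 0 := by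
    intro t
    induction t using Finset.induction_on with
    | empty => simpa using h
    | insert a t ha ih =>
      rcases abs_choice (μ a) with hμ | hμ
      · convert ih using 2
        ext i
        by_cases hi : i = a
        · subst hi; simp [ha, hμ]
        · simp [hi]
      · have h2 := hu.2.1 a (fun i => if i ∈ t then |μ i| else μ i)
        rw [← neg_ne_zero, ← h2] at ih
        convert ih using 2
        ext i
        by_cases hi : i = a
        · subst hi; simp [ha, hμ]
        · simp [hi]
  simpa using key Finset.univ

lemma injective_of_coeff_ne_zero {u : Laurent N} (hu : u ∈ Anti N) {μ : Fin N → ℤ}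
    (h : u.coeff μ ≠ 0) : Function.Injective μ := by
  intro i j hij
  by_contra hne
  have h1 := hu.1 (Equiv.swap i j) μ
  have h2 : μ ∘ Equiv.swap i j = μ := by
    ext l
    simp only [Function.comp_apply, Equiv.swap_apply_def]
    split_ifs with h3 h4
    · rw [h3, hij]
    · rw [h4, hij]
    · rfl
  rw [h2, Equiv.Perm.sign_swap hne] at h1
  apply h
  simp only [Units.val_neg, Units.val_one, Int.cast_neg, Int.cast_one, neg_mul, one_mul] at h1
  exact self_eq_neg.mp h1

lemma le_of_strictMono_odd {μ : Fin N → ℤ} (hμ : StrictMono μ) (hpos : ∀ i, 0 ≤ μ i)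
    (hodd : ∀ i, Odd (μ i)) (i : Fin N) : 2 * (i : ℤ) + 1 ≤ μ i := by
  obtain ⟨n, hn⟩ := i
  induction n with
  | zero =>
    obtain ⟨m, hm⟩ := hodd ⟨0, hn⟩
    have := hpos ⟨0, hn⟩
    simp only [CharP.cast_eq_zero]
    omega
  | succ n ih =>
    have h1 := ih (by omega)
    have h2 : μ ⟨n, by omega⟩ < μ ⟨n + 1, hn⟩ := hμ (by simp)
    obtain ⟨m, hm⟩ := hodd ⟨n, by omega⟩
    obtain ⟨m', hm'⟩ := hodd ⟨n + 1, hn⟩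
    push_cast at *
    omega

lemma eq_zero_of_mem_Anti {u : Laurent N} (hu : u ∈ Anti N)
    (hs : ∀ μ, nsq μ ≠ ρsq N → u.coeff μ = 0) (hρ : u.coeff (ρ N) = 0) : u = 0 := by
  by_contra hne
  have hex : ∃ μ, u.coeff μ ≠ 0 := by
    by_contra! hall
    exact hne (by ext μ; simpa using hall μ)
  obtain ⟨μ, hμ⟩ := hex
  have h1 := coeff_ne_zero_update hu hμ
  set ν : Fin N → ℤ := fun i => |μ i| with hν
  have hinj := injective_of_coeff_ne_zero hu h1
  set σ := Tuple.sort ν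
  have hm : StrictMono (ν ∘ σ) :=
    (Tuple.monotone_sort ν).strictMono_of_injective (hinj.comp σ.injective)
  have h2 : u.coeff (ν ∘ σ) ≠ 0 := by
    rw [hu.1]
    refine mul_ne_zero ?_ h1
    rw [Int.cast_ne_zero]
    exact (Equiv.Perm.sign σ).ne_zero
  have h3 : nsq (ν ∘ σ) = ρsq N := by
    by_contra h
    exact h2 (hs _ h)
  have hodd : ∀ i, Odd ((ν ∘ σ) i) := by
    intro i
    by_contra h
    exact h2 (hu.2.2 i _ h)
  have hle := le_of_strictMono_odd hm (fun i => abs_nonneg _) hodd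
  have hsq : ∀ i ∈ Finset.univ, (2 * ((i : Fin N) : ℤ) + 1) ^ 2 ≤ ((ν ∘ σ) i) ^ 2 := by
    intro i _
    have := hle i
    gcongr
  have heq := (Finset.sum_eq_sum_iff_of_le hsq).mp h3.symm
  apply h2
  rw [← hρ]
  congr 1
  ext i
  have h4 := heq i (Finset.mem_univ i)
  have h5 := hle i
  rw [ρ]
  nlinarith

/-- The loop equations determine a linear functional on symmetric Laurent polynomials: it is a
coefficient of the product with the Weyl denominator. -/
lemma sub_coeff_mem (K : Submodule ℂ (Laurent N)) (hKB : ∀ f ∈ K, f ∈ B N)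
    (hK : ∀ h ∈ B N, ∀ k : ℕ, 2 * (h * S N k) + E k h ∈ K) (f : Laurent N) (hf : f ∈ B N) :
    f - algebraMap ℂ _ ((δ * f).coeff (ρ N)) ∈ K := by
  have step : ∀ t : Finset ℤ, ρsq N ∉ t → ∃ f' ∈ B N, f - f' ∈ K ∧
      δ * f' = diag (fun μ => ∏ x ∈ t, ((nsq μ : ℂ) - x) / ((ρsq N : ℂ) - x)) (δ * f) := by
    intro t
    induction t using Finset.induction_on with
    | empty =>
      intro _
      refine ⟨f, hf, by simp, ?_⟩
      ext μ
      simp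
    | insert a t ha ih =>
      intro hρ
      rw [Finset.mem_insert, not_or] at hρ
      obtain ⟨f', hf', hff', hδ⟩ := ih hρ.2
      obtain ⟨g, hg, hJ⟩ := exists_J_eq K hK f' hf' 1 (one_mem _)
      rw [J_one] at hJ
      refine ⟨f' + ((ρsq N : ℂ) - a)⁻¹ • g, add_mem hf' ((B N).smul_mem (hKB g hg) _), ?_, ?_⟩
      · rw [← sub_sub]
        exact K.sub_mem hff' (K.smul_mem _ hg)
      · rw [mul_add, mul_smul_comm, ← hJ, hδ, H_eq_diag]
        ext μ
        have hne : (ρsq N : ℂ) - a ≠ 0 := by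
          rw [sub_ne_zero]
          exact_mod_cast hρ.1
        simp only [AddMonoidAlgebra.coeff_add, Finsupp.add_apply, AddMonoidAlgebra.coeff_smul,
          Finsupp.smul_apply, AddMonoidAlgebra.coeff_sub, Finsupp.sub_apply, diag_coeff,
          smul_eq_mul, Finset.prod_insert ha]
        field_simp
        ring
  obtain ⟨f', hf', hff', hδ⟩ := step (((δ * f).coeff.support.image nsq).erase (ρsq N)) (by simp)
  set r := (δ * f).coeff (ρ N) with hr
  have hone : ∀ μ : Fin N → ℤ, nsq μ = ρsq N → (δ * f').coeff μ = (δ * f).coeff μ := by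
    intro μ hμ
    rw [hδ, diag_coeff, Finset.prod_eq_one, one_mul]
    intro x hx
    rw [hμ, div_self]
    rw [sub_ne_zero]
    exact_mod_cast (Finset.ne_of_mem_erase hx).symm
  have hzero : ∀ μ : Fin N → ℤ, nsq μ ≠ ρsq N → (δ * f').coeff μ = 0 := by
    intro μ hμ
    rw [hδ, diag_coeff]
    by_cases h : (δ * f).coeff μ = 0
    · rw [h, mul_zero]
    · rw [Finset.prod_eq_zero (i := nsq μ), zero_mul]
      · rw [Finset.mem_erase]
        exact ⟨hμ, Finset.mem_image_of_mem _ (Finsupp.mem_support_iff.mpr h)⟩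
      · rw [sub_self, zero_div]
  have hA : ∀ x ∈ B N, δ * x ∈ Anti N := fun x hx => by
    rw [mul_comm]; exact mul_mem_Anti x hx _ δ_mem_Anti
  have hcst : δ * (f' - algebraMap ℂ _ r) = 0 := by
    refine eq_zero_of_mem_Anti (hA _ (sub_mem hf' ((B N).algebraMap_mem r))) (fun μ hμ => ?_) ?_
    · rw [mul_sub, mul_comm δ (algebraMap ℂ _ r), ← Algebra.smul_def,
        AddMonoidAlgebra.coeff_sub, Finsupp.sub_apply, hzero μ hμ, zero_sub, neg_eq_zero,
        AddMonoidAlgebra.coeff_smul, Finsupp.smul_apply, smul_eq_mul]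
      have := congrArg (fun u : Laurent N => u.coeff μ) (H_δ (N := N))
      rw [H_eq_diag] at this
      simp only [diag_coeff, AddMonoidAlgebra.coeff_smul, Finsupp.smul_apply, smul_eq_mul] at this
      have h2 : ((nsq μ : ℂ) - ρsq N) * (δ : Laurent N).coeff μ = 0 := by
        rw [sub_mul, this, sub_self]
      rcases mul_eq_zero.mp h2 with h | h
      · rw [sub_eq_zero] at h
        exact absurd (by exact_mod_cast h) hμ
      · rw [h, mul_zero]
    · rw [mul_sub, mul_comm δ (algebraMap ℂ _ r), ← Algebra.smul_def,
        AddMonoidAlgebra.coeff_sub, Finsupp.sub_apply, hone (ρ N) rfl,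
        AddMonoidAlgebra.coeff_smul, Finsupp.smul_apply, coeff_δ, ← hr, smul_eq_mul, mul_one,
        sub_self]
  have hδ0 : (δ : Laurent N) ≠ 0 := by
    intro h
    have := coeff_δ (N := N)
    rw [h] at this
    simp at this
  have := (mul_eq_zero.mp hcst).resolve_left hδ0
  rw [sub_eq_zero] at this
  rw [← this]
  exact hff'

end Laurent

section Eigenvalues

lemma trace_pow_eq_sum_roots {V : Type*} [AddCommGroup V] [Module ℂ V] [FiniteDimensional ℂ V]
    (f : Module.End ℂ V) (k : ℕ) :
    LinearMap.trace ℂ V (f ^ k) = (f.charpoly.roots.map (· ^ k)).sum := by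
  have hN : {x | f.maxGenEigenspace x ≠ ⊥} = (f.charpoly.roots.toFinset : Set ℂ) := by
    ext x
    rw [Set.mem_ofPred_eq, Finset.mem_coe, Multiset.mem_toFinset, ← Multiset.count_pos,
      Polynomial.count_roots, ← LinearMap.finrank_maxGenEigenspace_eq, Nat.pos_iff_ne_zero, ne_eq,
      ne_eq, Submodule.finrank_eq_zero]
  have hfin : {x | f.maxGenEigenspace x ≠ ⊥}.Finite := by rw [hN]; exact Finset.finite_toSet _
  have hinteg : DirectSum.IsInternal f.maxGenEigenspace :=
    DirectSum.isInternal_submodule_of_iSupIndep_of_iSup_eq_top f.independent_maxGenEigenspace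
      (Module.End.iSup_maxGenEigenspace_eq_top f)
  have hmaps : ∀ (n : ℕ) (x : ℂ), Set.MapsTo (f ^ n) (f.maxGenEigenspace x)
      (f.maxGenEigenspace x) := fun n x =>
    Module.End.mapsTo_maxGenEigenspace_of_comm ((Commute.refl f).pow_right n) x
  rw [LinearMap.trace_eq_sum_trace_restrict' hinteg hfin (hmaps k)]
  have hset : hfin.toFinset = f.charpoly.roots.toFinset := by
    ext x
    rw [Set.Finite.mem_toFinset, hN, Finset.mem_coe]
  rw [hset, Finset.sum_multiset_map_count]
  refine Finset.sum_congr rfl fun x _ => ?_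
  rw [Polynomial.count_roots, ← LinearMap.finrank_maxGenEigenspace_eq, nsmul_eq_mul]
  induction k with
  | zero =>
    have : (f ^ 0).restrict (hmaps 0 x) = LinearMap.id := by ext y; simp
    rw [this, LinearMap.trace_id, pow_zero, mul_one]
  | succ k ih =>
    have hf : Set.MapsTo f (f.maxGenEigenspace x) (f.maxGenEigenspace x) := by
      simpa using hmaps 1 x
    have h1 : (f ^ (k + 1)).restrict (hmaps (k + 1) x)
        = (f ^ k).restrict (hmaps k x) ∘ₗ f.restrict hf := by
      refine LinearMap.ext fun y => Subtype.ext ?_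
      change (f ^ (k + 1)) y = (f ^ k) (f y)
      rw [pow_succ, Module.End.mul_apply]
    have hcomm : Commute ((f ^ k).restrict (hmaps k x)) (f.restrict hf) := by
      refine LinearMap.ext fun y => Subtype.ext ?_
      change (f ^ k) (f y) = f ((f ^ k) y)
      rw [← Module.End.mul_apply, ← Module.End.mul_apply, ← pow_succ, ← pow_succ']
    have hnil : IsNilpotent (f.restrict hf - algebraMap ℂ _ x) :=
      f.isNilpotent_restrict_maxGenEigenspace_sub_algebraMap x
    rw [h1, LinearMap.trace_comp_eq_mul_of_commute_of_isNilpotent x hcomm hnil, ih, pow_succ]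
    ring

lemma matrix_trace_pow_eq {n : Type*} [Fintype n] [DecidableEq n] (M : Matrix n n ℂ) (k : ℕ) :
    (M ^ k).trace = (M.charpoly.roots.map (· ^ k)).sum := by
  have := trace_pow_eq_sum_roots (Matrix.toLin' M) k
  rwa [← Matrix.toLin'_pow, Matrix.trace_toLin'_eq, Matrix.charpoly_toLin'] at this

open Polynomial in
lemma roots_reverse_prod (R : Multiset ℂ) (hR : (0 : ℂ) ∉ R) :
    ((R.map fun r => (X - C r)).prod.reverse).roots = R.map (·⁻¹) := by
  induction R using Multiset.induction_on with
  | empty =>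
    have h : (1 : ℂ[X]).reverse = 1 := by
      rw [← C_1]
      exact reverse_C 1
    simp [h]
  | cons r R ih =>
    rw [Multiset.mem_cons, not_or] at hR
    have hr : r ≠ 0 := Ne.symm hR.1
    have h1 : (X - C r : ℂ[X]).reverse = C (-r) * (X - C r⁻¹) := by
      have h2 : (X - C r : ℂ[X]) = 1 * X + C (-r) := by simp [sub_eq_add_neg]
      have h3 : (1 : ℂ[X]).reverse = 1 := by
        rw [← C_1]
        exact reverse_C 1
      rw [h2, reverse_add_C, reverse_mul_X, h3, mul_sub, ← C_mul]
      simp [hr]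
      ring
    have h4 : ((R.map fun r => (X - C r)).prod : ℂ[X]).reverse ≠ 0 := by
      rw [ne_eq, reverse_eq_zero]
      exact (monic_multisetProd_X_sub_C R).ne_zero
    rw [Multiset.map_cons, Multiset.prod_cons, reverse_mul_of_domain, h1, mul_assoc,
      roots_C_mul _ (neg_ne_zero.mpr hr), roots_mul (mul_ne_zero (X_sub_C_ne_zero _) h4),
      roots_X_sub_C, ih hR.2, Multiset.map_cons, Multiset.singleton_add]

open Polynomial in
lemma roots_map_inv {n : Type*} [Fintype n] [DecidableEq n] (M : Matrix n n ℂ)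
    (hM : M * Mᵀ = 1) :
    M.charpoly.roots.map (·⁻¹) = M.charpoly.roots ∧ (0 : ℂ) ∉ M.charpoly.roots := by
  have hunit : IsUnit M := isUnit_iff_exists.mpr ⟨Mᵀ, hM, mul_eq_one_comm.mp hM⟩
  have hinv : M⁻¹ = Mᵀ := Matrix.inv_eq_right_inv hM
  have hdet : M.det ≠ 0 := ((Matrix.isUnit_iff_isUnit_det _).mp hunit).ne_zero
  have h0 : (0 : ℂ) ∉ M.charpoly.roots := by
    intro h
    rw [Polynomial.mem_roots', Polynomial.IsRoot.def, ← Polynomial.coeff_zero_eq_eval_zero] at h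
    apply hdet
    rw [Matrix.det_eq_sign_charpoly_coeff, h.2, mul_zero]
  refine ⟨?_, h0⟩
  have h1 := Matrix.charpoly_inv M hunit
  rw [hinv, Matrix.charpoly_transpose, ← Matrix.reverse_charpoly] at h1
  have h2 : M.charpoly = (M.charpoly.roots.map fun r => (X - C r)).prod :=
    (IsAlgClosed.splits M.charpoly).eq_prod_roots_of_monic M.charpoly_monic
  have h3 := roots_reverse_prod _ h0
  rw [← h2] at h3
  rw [← h3]
  conv_rhs => rw [h1]
  rw [Ring.inverse_eq_inv', show ((-1) ^ Fintype.card n * C M.det⁻¹ : ℂ[X])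
    = C ((-1) ^ Fintype.card n * M.det⁻¹) by simp, roots_C_mul]
  simp [hdet]

lemma exists_multiset_of_map_inv (R : Multiset ℂ) (h0 : (0 : ℂ) ∉ R) (hR : R.map (·⁻¹) = R) :
    ∃ (t : Multiset ℂ) (a b : ℕ), a ≤ 1 ∧ b ≤ 1 ∧
      R = t + t.map (·⁻¹) + Multiset.replicate a 1 + Multiset.replicate b (-1) := by
  induction hn : R.card using Nat.strong_induction_on generalizing R with
  | _ n ih =>
  have peel : ∀ (r : ℂ) (R' : Multiset ℂ), R = r ::ₘ r⁻¹ ::ₘ R' →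
      ∃ (t : Multiset ℂ) (a b : ℕ), a ≤ 1 ∧ b ≤ 1 ∧
      R = t + t.map (·⁻¹) + Multiset.replicate a 1 + Multiset.replicate b (-1) := by
    intro r R' hRR
    have hR' : R'.map (·⁻¹) = R' := by
      rw [hRR, Multiset.map_cons, Multiset.map_cons, inv_inv, Multiset.cons_swap,
        Multiset.cons_inj_right, Multiset.cons_inj_right] at hR
      exact hR
    obtain ⟨t, a, b, ha, hb, hR2⟩ := ih R'.card (by rw [← hn, hRR]; simp) R'
      (fun h => h0 (by rw [hRR]; simp [h])) hR' rfl
    refine ⟨r ::ₘ t, a, b, ha, hb, ?_⟩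
    rw [hRR, Multiset.map_cons]
    simp only [Multiset.cons_add, Multiset.add_cons]
    rw [← hR2, Multiset.cons_swap]
  by_cases hex : ∃ r ∈ R, r ≠ r⁻¹
  · obtain ⟨r, hr, hne⟩ := hex
    obtain ⟨R1, hR1⟩ := Multiset.exists_cons_of_mem hr
    have h2 : r⁻¹ ∈ R := by
      rw [← hR]
      exact Multiset.mem_map_of_mem _ hr
    rw [hR1, Multiset.mem_cons, or_iff_right (Ne.symm hne)] at h2
    obtain ⟨R2, hR2⟩ := Multiset.exists_cons_of_mem h2
    exact peel r R2 (by rw [hR1, hR2])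
  · push Not at hex
    have hpm : ∀ r ∈ R, r = 1 ∨ r = -1 := by
      intro r hr
      have hr0 : r ≠ 0 := by rintro rfl; exact h0 hr
      have h1 := hex r hr
      have h2 : r * r = 1 := by
        nth_rewrite 2 [h1]
        exact mul_inv_cancel₀ hr0
      exact mul_self_eq_one_iff.mp h2
    have two : ∀ x : ℂ, x⁻¹ = x → 2 ≤ R.count x → ∃ R', R = x ::ₘ x⁻¹ ::ₘ R' := by
      intro x hx hc
      rw [Multiset.le_count_iff_replicate_le] at hc
      obtain ⟨R', hR'⟩ := Multiset.le_iff_exists_add.mp hc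
      refine ⟨R', ?_⟩
      rw [hx, hR']
      simp [Multiset.replicate_succ]
    by_cases h1 : 2 ≤ R.count 1
    · obtain ⟨R', h⟩ := two 1 (by simp) h1
      exact peel _ _ h
    by_cases h2 : 2 ≤ R.count (-1)
    · obtain ⟨R', h⟩ := two (-1) (by norm_num) h2
      exact peel _ _ h
    refine ⟨0, R.count 1, R.count (-1), by omega, by omega, ?_⟩
    ext x
    simp only [Multiset.map_zero, add_zero, zero_add, Multiset.count_add, Multiset.count_replicate]
    by_cases hx : x ∈ R
    · rcases hpm x hx with rfl | rfl
      · norm_num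
      · norm_num
    · rw [Multiset.count_eq_zero_of_notMem hx]
      split_ifs with h3 h4 h4
      · subst h3; norm_num at h4
      · subst h3; rw [Multiset.count_eq_zero_of_notMem hx]
      · subst h4; rw [Multiset.count_eq_zero_of_notMem hx]
      · rfl

lemma exists_eigenvalues (N : ℕ) (M : Matrix (Fin (2 * N + 1)) (Fin (2 * N + 1)) ℂ)
    (hM : M * Mᵀ = 1) (hdet : M.det = 1) :
    ∃ z : Fin N → ℂ, (∀ i, z i ≠ 0) ∧
      ∀ k : ℕ, (M ^ k).trace = 1 + ∑ i, ((z i) ^ k + ((z i)⁻¹) ^ k) := by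
  obtain ⟨hinv, h0⟩ := roots_map_inv M hM
  obtain ⟨t, a, b, ha, hb, hR⟩ := exists_multiset_of_map_inv _ h0 hinv
  have ht0 : ∀ x ∈ t, x ≠ 0 := by
    rintro x hx rfl
    exact h0 (by rw [hR]; simp [hx])
  have hcard : M.charpoly.roots.card = 2 * N + 1 := by
    rw [IsAlgClosed.card_roots_eq_natDegree, Matrix.charpoly_natDegree_eq_dim, Fintype.card_fin]
  have hprod := Matrix.det_eq_prod_roots_charpoly M
  rw [hdet, hR, Multiset.prod_add, Multiset.prod_add, Multiset.prod_add, Multiset.prod_map_inv,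
    Multiset.map_id', mul_inv_cancel₀ (fun h => ht0 0 (Multiset.prod_eq_zero_iff.mp h) rfl),
    Multiset.prod_replicate, Multiset.prod_replicate, one_pow, one_mul, one_mul] at hprod
  have hb0 : b = 0 := by
    by_contra h
    obtain rfl : b = 1 := by omega
    norm_num at hprod
  subst hb0
  rw [hR] at hcard
  simp only [Multiset.card_add, Multiset.card_map, Multiset.card_replicate] at hcard
  obtain rfl : a = 1 := by omega
  have htc : t.toList.length = N := by rw [Multiset.length_toList]; omega
  refine ⟨fun i => t.toList.get (i.cast htc.symm), fun i => ht0 _ ?_, fun k => ?_⟩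
  · rw [← Multiset.mem_toList]
    exact List.get_mem _ _
  · have hsum : ∀ g : ℂ → ℂ, ∑ i : Fin N, g (t.toList.get (i.cast htc.symm)) = (t.map g).sum := by
      intro g
      conv_rhs => rw [← Multiset.coe_toList t]
      rw [Multiset.map_coe, Multiset.sum_coe, ← Fin.sum_univ_fun_getElem]
      exact Fintype.sum_equiv (finCongr htc.symm) _ _ fun i => rfl
    rw [matrix_trace_pow_eq, hR, hsum fun x => x ^ k + x⁻¹ ^ k]
    simp [Multiset.sum_map_add]
    ring

end Eigenvalues

section Laurent

variable {N : ℕ}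

/-- Evaluation of Laurent polynomials at a point with nonzero coordinates. -/
def evalAt (x : Fin N → ℂˣ) : Laurent N →ₐ[ℂ] ℂ :=
  AddMonoidAlgebra.lift ℂ ℂ (Fin N → ℤ)
    { toFun := fun m => ((∏ i, x i ^ (m.toAdd i) : ℂˣ) : ℂ)
      map_one' := by simp
      map_mul' := by
        intro a b
        simp [_root_.zpow_add, Finset.prod_mul_distrib] }

lemma evalAt_w (x : Fin N → ℂˣ) (i : Fin N) (a : ℤ) : evalAt x (w i a) = ((x i ^ a : ℂˣ) : ℂ) := by
  rw [evalAt, w, AddMonoidAlgebra.lift_single]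
  simp only [MonoidHom.coe_mk, OneHom.coe_mk, toAdd_ofAdd, one_smul]
  rw [Finset.prod_eq_single i]
  · simp
  · intro j _ hj
    simp [Pi.single_eq_of_ne hj]
  · simp

lemma exists_algHom (M : Matrix (Fin (2 * N + 1)) (Fin (2 * N + 1)) ℂ)
    (hM : M * Mᵀ = 1) (hdet : M.det = 1) :
    ∃ ψ : Laurent N →ₐ[ℂ] ℂ, ∀ k : ℕ, ψ (p k) = (M ^ k).trace := by
  obtain ⟨z, hz, h⟩ := exists_eigenvalues N M hM hdet
  choose y hy using fun i => IsAlgClosed.exists_pow_nat_eq (z i) two_pos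
  have hy0 : ∀ i, y i ≠ 0 := by
    intro i h
    apply hz i
    rw [← hy, h]
    simp
  refine ⟨evalAt fun i => Units.mk0 (y i) (hy0 i), fun k => ?_⟩
  rw [h, p, map_add, map_one, map_sum]
  congr 1
  refine Finset.sum_congr rfl fun i _ => ?_
  rw [c, map_add, evalAt_w, evalAt_w, _root_.zpow_neg, _root_.zpow_mul]
  simp only [zpow_natCast, Units.val_inv_eq_inv_val, Units.val_pow_eq_pow_val,
    inv_pow]
  norm_cast
  simp only [Units.val_pow_eq_pow_val, Units.val_mk0, hy, Units.val_inv_eq_inv_val]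

end Laurent

section ExpCurve

variable {𝔸 : Type*} [NormedRing 𝔸] [NormedAlgebra ℝ 𝔸] [CompleteSpace 𝔸]

lemma hasDerivAt_exp_smul_mul_pow (X A : 𝔸) (k : ℕ) (t : ℝ) :
    HasDerivAt (fun t : ℝ => (NormedSpace.exp (t • X) * A) ^ k)
      (∑ j ∈ Finset.range k, (NormedSpace.exp (t • X) * A) ^ j * X *
        (NormedSpace.exp (t • X) * A) ^ (k - j)) t := by
  induction k with
  | zero => simpa using hasDerivAt_const t (1 : 𝔸)
  | succ k ih =>
    have h : HasDerivAt (fun t : ℝ => NormedSpace.exp (t • X) * A)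
        (X * (NormedSpace.exp (t • X) * A)) t := by
      rw [← mul_assoc]
      exact (hasDerivAt_exp_smul_const' (𝕂 := ℝ) X t).mul_const A
    simp_rw [pow_succ (NormedSpace.exp (_ • X) * A) k]
    refine (ih.mul h).congr_deriv ?_
    rw [Finset.sum_range_succ, Finset.sum_mul]
    congr 1
    · refine Finset.sum_congr rfl fun j hj => ?_
      have := Finset.mem_range.1 hj
      rw [Nat.sub_add_comm this.le, pow_succ _ (k - j), mul_assoc _ (_ ^ (k - j))]
    · rw [Nat.add_sub_cancel_left, pow_one, mul_assoc]

lemma hasDerivAt_clm_exp_smul_mul_pow (L : 𝔸 →L[ℝ] ℝ) (X A : 𝔸) (k : ℕ) (t : ℝ) :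
    HasDerivAt (fun t : ℝ => L ((NormedSpace.exp (t • X) * A) ^ k))
      (∑ j ∈ Finset.range k, L ((NormedSpace.exp (t • X) * A) ^ j * X *
        (NormedSpace.exp (t • X) * A) ^ (k - j))) t := by
  rw [← map_sum]
  exact L.hasFDerivAt.comp_hasDerivAt t (hasDerivAt_exp_smul_mul_pow X A k t)

end ExpCurve

section Rotation

/-- The infinitesimal rotation in the plane of the coordinates `i` and `j`. -/
def rot {n : Type*} [DecidableEq n] (i j : n) : Matrix n n ℝ :=
  Matrix.single i j 1 - Matrix.single j i 1

lemma rot_transpose {n : Type*} [DecidableEq n] (i j : n) : (rot i j)ᵀ = -rot i j := by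
  simp [rot, transpose_sub, transpose_single]

variable {n : Type*} [Fintype n] [DecidableEq n]

lemma mem_SO_iff {A : Matrix n n ℝ} :
    A ∈ Matrix.specialOrthogonalGroup n ℝ ↔ A * Aᵀ = 1 ∧ A.det = 1 := by
  rw [mem_specialOrthogonalGroup_iff, mem_orthogonalGroup_iff]

lemma exp_mem_SO {X : Matrix n n ℝ} (hX : Xᵀ = -X) :
    NormedSpace.exp X ∈ Matrix.specialOrthogonalGroup n ℝ := by
  have key : ∀ Y : Matrix n n ℝ, Yᵀ = -Y → NormedSpace.exp Y * (NormedSpace.exp Y)ᵀ = 1 := by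
    intro Y hY
    rw [← Matrix.exp_transpose, hY, ← Matrix.exp_add_of_commute _ _ (Commute.refl Y).neg_right,
      add_neg_cancel, NormedSpace.exp_zero]
  refine mem_SO_iff.2 ⟨key X hX, ?_⟩
  have hY : ((1 / 2 : ℝ) • X)ᵀ = -((1 / 2 : ℝ) • X) := by rw [transpose_smul, hX, smul_neg]
  have h := congrArg Matrix.det (key _ hY)
  rw [det_mul, det_transpose, det_one] at h
  have h2 : X = (1 / 2 : ℝ) • X + (1 / 2 : ℝ) • X := by rw [← add_smul]; norm_num
  rw [h2, Matrix.exp_add_of_commute _ _ (Commute.refl _), det_mul, h]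

open scoped Matrix.Norms.Operator in
lemma hasDerivAt_trace_mul_pow (Y X A : Matrix n n ℝ) (k : ℕ) (t : ℝ) :
    HasDerivAt (fun t : ℝ => (Y * (NormedSpace.exp (t • X) * A) ^ k).trace)
      (∑ j ∈ Finset.range k, (Y * ((NormedSpace.exp (t • X) * A) ^ j * X *
        (NormedSpace.exp (t • X) * A) ^ (k - j))).trace) t :=
  hasDerivAt_clm_exp_smul_mul_pow
    (LinearMap.toContinuousLinearMap (Matrix.traceLinearMap n ℝ ℝ ∘ₗ LinearMap.mulLeft ℝ Y)) X A k t

lemma hasDerivAt_trace_pow (X A : Matrix n n ℝ) (k : ℕ) (t : ℝ) :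
    HasDerivAt (fun t : ℝ => ((NormedSpace.exp (t • X) * A) ^ k).trace)
      (k * (X * (NormedSpace.exp (t • X) * A) ^ k).trace) t := by
  have h := hasDerivAt_trace_mul_pow 1 X A k t
  simp only [Matrix.one_mul] at h
  convert h using 1
  rw [← nsmul_eq_mul]
  nth_rewrite 1 [← Finset.card_range k]
  rw [← Finset.sum_const]
  refine Finset.sum_congr rfl fun j hj => ?_
  rw [Matrix.trace_mul_comm _ (_ ^ (k - j)), ← Matrix.mul_assoc, ← pow_add,
    Nat.sub_add_cancel (Finset.mem_range.1 hj).le, Matrix.trace_mul_comm]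

lemma trace_rot_mul (i j : n) (M : Matrix n n ℝ) : (rot i j * M).trace = M j i - M i j := by
  rw [rot, Matrix.sub_mul, trace_sub, trace_single_mul, trace_single_mul, one_smul, one_smul]

lemma sum_trace_rot_mul_mul (M M' : Matrix n n ℝ) :
    ∑ i, ∑ j, (rot i j * M).trace * (rot i j * M').trace
      = 2 * ((Mᵀ * M').trace - (M * M').trace) := by
  simp only [trace_rot_mul]
  simp only [Matrix.trace, diag_apply, Matrix.mul_apply, transpose_apply]
  have h1 : ∑ i, ∑ j, M i j * M' i j = ∑ i, ∑ j, M j i * M' j i := Finset.sum_comm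
  have h2 : ∑ i, ∑ j, M j i * M' i j = ∑ i, ∑ j, M i j * M' j i := Finset.sum_comm
  have : ∀ i j, (M j i - M i j) * (M' j i - M' i j)
      = M j i * M' j i + M i j * M' i j - M i j * M' j i - M j i * M' i j := fun i j => by ring
  simp only [this, Finset.sum_sub_distrib, Finset.sum_add_distrib]
  rw [h1, h2]
  ring

lemma sum_trace_rot_mul_rot_mul (M M' : Matrix n n ℝ) :
    ∑ i, ∑ j, (rot i j * (M * rot i j * M')).trace
      = 2 * ((Mᵀ * M').trace - M.trace * M'.trace) := by
  have key : ∀ i j k l : n, (Matrix.single i j (1 : ℝ) * (M * Matrix.single k l 1 * M')).trace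
      = M j k * M' l i := by
    intro i j k l
    rw [Matrix.mul_assoc, trace_single_mul, one_smul, Matrix.mul_apply,
      Finset.sum_eq_single k]
    · rw [Matrix.single_mul_apply_same, one_mul]
    · intro b _ hb
      rw [Matrix.single_mul_apply_of_ne _ _ _ _ _ hb, mul_zero]
    · simp
  have : ∀ i j, (rot i j * (M * rot i j * M')).trace
      = M j i * M' j i + M i j * M' i j - M j j * M' i i - M i i * M' j j := by
    intro i j
    simp only [rot, Matrix.sub_mul, Matrix.mul_sub, trace_sub, key]
    ring
  have h1 : ∑ i, ∑ j, M i j * M' i j = ∑ i, ∑ j, M j i * M' j i := Finset.sum_comm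
  simp only [this, Finset.sum_sub_distrib, Finset.sum_add_distrib]
  rw [h1]
  simp only [Matrix.trace, diag_apply, Matrix.mul_apply, transpose_apply]
  rw [Finset.sum_mul_sum]
  have h2 : ∑ i, ∑ j, M j j * M' i i = ∑ i, ∑ j, M i i * M' j j := Finset.sum_comm
  rw [h2]
  ring

lemma trace_transpose_pow_mul_pow {A : Matrix n n ℝ} (hA : A * Aᵀ = 1) (a b : ℕ) :
    ((A ^ a)ᵀ * A ^ b).trace = (A ^ ((b : ℤ) - a).natAbs).trace := by
  have hA' : Aᵀ * A = 1 := mul_eq_one_comm.1 hA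
  have h : ∀ m : ℕ, (A ^ m)ᵀ * A ^ m = 1 := by
    intro m
    rw [transpose_pow]
    induction m with
    | zero => simp
    | succ m ih => rw [pow_succ, pow_succ' A, Matrix.mul_assoc, ← Matrix.mul_assoc _ A, hA',
      Matrix.one_mul, ih]
  rcases le_total a b with hab | hab
  · obtain ⟨d, rfl⟩ := Nat.exists_eq_add_of_le hab
    rw [pow_add, ← Matrix.mul_assoc, h, Matrix.one_mul]
    congr 2
    omega
  · obtain ⟨d, rfl⟩ := Nat.exists_eq_add_of_le hab
    rw [pow_add, transpose_mul, Matrix.mul_assoc, h, Matrix.mul_one, trace_transpose]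
    congr 2
    omega

end Rotation

section Lift

variable {N : ℕ}

lemma exists_eval_eq_trace (N : ℕ) : ∃ ψ : Matrix (Fin (2 * N + 1)) (Fin (2 * N + 1)) ℝ →
    (Laurent N →ₐ[ℂ] ℂ), ∀ A ∈ Matrix.specialOrthogonalGroup (Fin (2 * N + 1)) ℝ, ∀ k : ℕ,
      ψ A (p k) = ((A ^ k).trace : ℝ) := by
  have : ∀ A : Matrix (Fin (2 * N + 1)) (Fin (2 * N + 1)) ℝ, ∃ ψ : Laurent N →ₐ[ℂ] ℂ,
      A ∈ Matrix.specialOrthogonalGroup (Fin (2 * N + 1)) ℝ → ∀ k : ℕ,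
        ψ (p k) = ((A ^ k).trace : ℝ) := by
    intro A
    by_cases hA : A ∈ Matrix.specialOrthogonalGroup (Fin (2 * N + 1)) ℝ
    · obtain ⟨h1, h2⟩ := mem_SO_iff.1 hA
      obtain ⟨ψ, hψ⟩ := exists_algHom (Complex.ofRealHom.mapMatrix A)
        (by
          have := congrArg Complex.ofRealHom.mapMatrix h1
          rwa [map_mul, map_one] at this)
        (by rw [← RingHom.map_det, h2, map_one])
      refine ⟨ψ, fun _ k => ?_⟩
      rw [hψ, ← map_pow]
      exact (AddMonoidHom.map_trace Complex.ofRealHom (A ^ k)).symm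
    · exact ⟨evalAt 1, fun h => absurd h hA⟩
  choose ψ hψ using this
  exact ⟨ψ, hψ⟩

/-- The evaluation of Laurent polynomials at (square roots of) the eigenvalues of a special
orthogonal matrix. -/
def ψ (A : Matrix (Fin (2 * N + 1)) (Fin (2 * N + 1)) ℝ) : Laurent N →ₐ[ℂ] ℂ :=
  (exists_eval_eq_trace N).choose A

lemma ψ_p {A : Matrix (Fin (2 * N + 1)) (Fin (2 * N + 1)) ℝ}
    (hA : A ∈ Matrix.specialOrthogonalGroup (Fin (2 * N + 1)) ℝ) (k : ℕ) :
    ψ A (p k) = ((A ^ k).trace : ℝ) :=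
  (exists_eval_eq_trace N).choose_spec A hA k

lemma p_neg (k : ℤ) : (p (-k) : Laurent N) = p k := by
  simp only [p, c_neg]

lemma p_natAbs (k : ℤ) : (p (k.natAbs : ℤ) : Laurent N) = p k := by
  rcases Int.natAbs_eq k with h | h
  · rw [← h]
  · nth_rewrite 2 [h]
    rw [p_neg]

lemma ofReal_trace_transpose_pow_mul_pow {A : Matrix (Fin (2 * N + 1)) (Fin (2 * N + 1)) ℝ}
    (hA : A ∈ Matrix.specialOrthogonalGroup (Fin (2 * N + 1)) ℝ) (a b : ℕ) :
    ((((A ^ a)ᵀ * A ^ b).trace : ℝ) : ℂ) = ψ A (p ((b : ℤ) - a)) := by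
  rw [trace_transpose_pow_mul_pow (mem_SO_iff.1 hA).1, ← ψ_p hA, p_natAbs]

lemma E_p (k l : ℤ) : (E k (p l) : Laurent N) = (2 * l : ℂ) • (p (k + l) - p (k - l)) := by
  simp only [E, D_p, mul_smul_comm, s_mul_s, ← Finset.smul_sum, Finset.sum_sub_distrib]
  rw [p, p, add_sub_add_left_eq_sub]

lemma E_algebraMap (k : ℤ) (r : ℂ) : E k (algebraMap ℂ (Laurent N) r) = 0 := by
  simp only [E, D_algebraMap, mul_zero, Finset.sum_const_zero]

lemma E_add (k : ℤ) (f g : Laurent N) : E k (f + g) = E k f + E k g := by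
  simp only [E, map_add, mul_add, Finset.sum_add_distrib]

/-- `F` is a continuous extension of `A ↦ ψ A h` to all matrices, and `F' X` is its
derivative along the rotations generated by `X`. -/
structure IsLift (h : Laurent N) (F : Matrix (Fin (2 * N + 1)) (Fin (2 * N + 1)) ℝ → ℂ)
    (F' : Matrix (Fin (2 * N + 1)) (Fin (2 * N + 1)) ℝ →
      Matrix (Fin (2 * N + 1)) (Fin (2 * N + 1)) ℝ → ℂ) : Prop where
  continuous : Continuous F
  continuous_deriv : ∀ X, Continuous (F' X)
  hasDerivAt : ∀ X A (t : ℝ), HasDerivAt (fun t : ℝ => F (NormedSpace.exp (t • X) * A))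
    (F' X (NormedSpace.exp (t • X) * A)) t
  eq : ∀ A ∈ Matrix.specialOrthogonalGroup (Fin (2 * N + 1)) ℝ, F A = ψ A h
  sum_eq : ∀ k : ℕ, ∀ A ∈ Matrix.specialOrthogonalGroup (Fin (2 * N + 1)) ℝ,
    ∑ i, ∑ j, (((rot i j * A ^ k).trace : ℝ) : ℂ) * F' (rot i j) A = -ψ A (E k h)

lemma exists_isLift {h : Laurent N} (hh : h ∈ B N) : ∃ F F', IsLift h F F' := by
  refine Algebra.adjoin_induction (fun x hx => ?_) (fun r => ?_) (fun f g _ _ hf hg => ?_)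
    (fun f g _ _ hf hg => ?_) hh
  · obtain ⟨l, rfl⟩ := hx
    refine ⟨fun A => ((A ^ l).trace : ℝ), fun X A => ((l * (X * A ^ l).trace : ℝ) : ℂ), ?_, ?_, ?_,
      ?_, ?_⟩
    · fun_prop
    · intro X
      fun_prop
    · exact fun X A t => (hasDerivAt_trace_pow X A l t).ofReal_comp
    · exact fun A hA => (ψ_p hA l).symm
    · intro k A hA
      have h1 : ∀ i j, (((rot i j * A ^ k).trace : ℝ) : ℂ) * ((l * (rot i j * A ^ l).trace : ℝ) : ℂ)
          = l * (((rot i j * A ^ k).trace * (rot i j * A ^ l).trace : ℝ) : ℂ) := by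
        intro i j
        push_cast
        ring
      simp only [h1, ← Finset.mul_sum, ← Complex.ofReal_sum]
      rw [sum_trace_rot_mul_mul, Complex.ofReal_mul, Complex.ofReal_sub,
        ofReal_trace_transpose_pow_mul_pow hA, ← pow_add, ← ψ_p hA, E_p, map_smul, map_sub,
        ← p_neg ((k : ℤ) - l), neg_sub, Nat.cast_add, smul_eq_mul]
      push_cast
      ring
  · refine ⟨fun _ => r, fun _ _ => 0, continuous_const, fun _ => continuous_const,
      fun X A t => hasDerivAt_const t r, fun A _ => ?_, fun k A _ => ?_⟩
    · rw [AlgHom.commutes]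
      rfl
    · simp only [mul_zero, Finset.sum_const_zero, E_algebraMap, map_zero, neg_zero]
  · obtain ⟨F, F', hF⟩ := hf
    obtain ⟨G, G', hG⟩ := hg
    refine ⟨F + G, F' + G', hF.continuous.add hG.continuous,
      fun X => (hF.continuous_deriv X).add (hG.continuous_deriv X),
      fun X A t => (hF.hasDerivAt X A t).add (hG.hasDerivAt X A t), fun A hA => ?_,
      fun k A hA => ?_⟩
    · rw [Pi.add_apply, hF.eq A hA, hG.eq A hA, map_add]
    · simp only [Pi.add_apply, mul_add, Finset.sum_add_distrib]
      rw [hF.sum_eq k A hA, hG.sum_eq k A hA, E_add, map_add]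
      ring
  · obtain ⟨F, F', hF⟩ := hf
    obtain ⟨G, G', hG⟩ := hg
    refine ⟨F * G, fun X A => F' X A * G A + F A * G' X A, hF.continuous.mul hG.continuous,
      fun X => ((hF.continuous_deriv X).mul hG.continuous).add
        (hF.continuous.mul (hG.continuous_deriv X)),
      fun X A t => (hF.hasDerivAt X A t).mul (hG.hasDerivAt X A t), fun A hA => ?_,
      fun k A hA => ?_⟩
    · rw [Pi.mul_apply, hF.eq A hA, hG.eq A hA, map_mul]
    · have h1 : ∀ i j, (((rot i j * A ^ k).trace : ℝ) : ℂ) *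
          (F' (rot i j) A * G A + F A * G' (rot i j) A)
          = (((rot i j * A ^ k).trace : ℝ) : ℂ) * F' (rot i j) A * G A
            + F A * ((((rot i j * A ^ k).trace : ℝ) : ℂ) * G' (rot i j) A) := by
        intro i j
        ring
      simp only [h1, Finset.sum_add_distrib, ← Finset.sum_mul, ← Finset.mul_sum]
      rw [hF.sum_eq k A hA, hG.sum_eq k A hA, hF.eq A hA, hG.eq A hA, E_mul, map_add, map_mul,
        map_mul]
      ring

end Lift

section Haar

variable {N : ℕ}

instance : BorelSpace (Matrix (Fin (2 * N + 1)) (Fin (2 * N + 1)) ℝ) :=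
  inferInstanceAs (BorelSpace (Fin (2 * N + 1) → Fin (2 * N + 1) → ℝ))

lemma measurableSet_SO : MeasurableSet
    {A | A ∈ Matrix.specialOrthogonalGroup (Fin (2 * N + 1)) ℝ} := by
  have : {A | A ∈ Matrix.specialOrthogonalGroup (Fin (2 * N + 1)) ℝ}
      = {A | A * Aᵀ = 1} ∩ {A | A.det = 1} := by
    ext A
    exact mem_SO_iff
  rw [this]
  refine ((isClosed_eq ?_ continuous_const).inter (isClosed_eq ?_ continuous_const)).measurableSet
  · fun_prop
  · fun_prop

lemma exists_bound_SO {G : Matrix (Fin (2 * N + 1)) (Fin (2 * N + 1)) ℝ → ℂ} (hG : Continuous G) :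
    ∃ C, ∀ A ∈ Matrix.specialOrthogonalGroup (Fin (2 * N + 1)) ℝ, ‖G A‖ ≤ C := by
  have hK : IsCompact (Set.univ.pi fun _ : Fin (2 * N + 1) =>
      Set.univ.pi fun _ : Fin (2 * N + 1) => Set.Icc (-1 : ℝ) 1) :=
    isCompact_univ_pi fun _ => isCompact_univ_pi fun _ => isCompact_Icc
  obtain ⟨C, hC⟩ := hK.exists_bound_of_continuousOn (f := G) hG.continuousOn
  refine ⟨C, fun A hA => hC A ?_⟩
  intro i _ j _
  have h := entry_norm_bound_of_unitary (mem_specialOrthogonalGroup_iff.1 hA).1 i j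
  rw [Real.norm_eq_abs, abs_le] at h
  exact h

variable {μ : Measure (Matrix (Fin (2 * N + 1)) (Fin (2 * N + 1)) ℝ)} [IsProbabilityMeasure μ]

lemma ae_mem_SO (hsupp : μ {A | A ∈ Matrix.specialOrthogonalGroup (Fin (2 * N + 1)) ℝ} = 1) :
    ∀ᵐ A ∂μ, A ∈ Matrix.specialOrthogonalGroup (Fin (2 * N + 1)) ℝ :=
  (mem_ae_iff_prob_eq_one measurableSet_SO).2 hsupp

lemma integrable_of_continuous
    (hsupp : μ {A | A ∈ Matrix.specialOrthogonalGroup (Fin (2 * N + 1)) ℝ} = 1)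
    {G : Matrix (Fin (2 * N + 1)) (Fin (2 * N + 1)) ℝ → ℂ} (hG : Continuous G) :
    Integrable G μ := by
  obtain ⟨C, hC⟩ := exists_bound_SO hG
  exact Integrable.of_bound hG.aestronglyMeasurable C
    ((ae_mem_SO hsupp).mono fun A hA => hC A hA)

lemma integral_deriv_eq_zero
    (hsupp : μ {A | A ∈ Matrix.specialOrthogonalGroup (Fin (2 * N + 1)) ℝ} = 1)
    (hinv : ∀ g ∈ Matrix.specialOrthogonalGroup (Fin (2 * N + 1)) ℝ,
      μ.map (fun A => g * A) = μ)
    {X : Matrix (Fin (2 * N + 1)) (Fin (2 * N + 1)) ℝ} (hX : Xᵀ = -X)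
    {W W' : Matrix (Fin (2 * N + 1)) (Fin (2 * N + 1)) ℝ → ℂ} (hW : Continuous W)
    (hW' : Continuous W') (h : ∀ A (t : ℝ), HasDerivAt
      (fun t : ℝ => W (NormedSpace.exp (t • X) * A)) (W' (NormedSpace.exp (t • X) * A)) t) :
    ∫ A, W' A ∂μ = 0 := by
  have hg : ∀ t : ℝ, NormedSpace.exp (t • X)
      ∈ Matrix.specialOrthogonalGroup (Fin (2 * N + 1)) ℝ :=
    fun t => exp_mem_SO (by rw [transpose_smul, hX, smul_neg])
  have hmul : ∀ t : ℝ, Continuous fun A => NormedSpace.exp (t • X) * A := fun t => by fun_prop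
  obtain ⟨C, hC⟩ := exists_bound_SO hW'
  have key := (hasDerivAt_integral_of_dominated_loc_of_deriv_le (μ := μ) (x₀ := (0 : ℝ))
    (F := fun t A => W (NormedSpace.exp (t • X) * A))
    (F' := fun t A => W' (NormedSpace.exp (t • X) * A)) (s := Set.univ) (bound := fun _ => C)
    Filter.univ_mem
    (Filter.Eventually.of_forall fun t => (hW.comp (hmul t)).aestronglyMeasurable)
    (integrable_of_continuous hsupp (hW.comp (hmul 0)))
    (hW'.comp (hmul 0)).aestronglyMeasurable
    ((ae_mem_SO hsupp).mono fun A hA t _ => hC _ (mul_mem (hg t) hA))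
    (integrable_const C)
    (Filter.Eventually.of_forall fun A t _ => h A t)).2
  have hconst : ∀ t : ℝ, ∫ A, W (NormedSpace.exp (t • X) * A) ∂μ = ∫ A, W A ∂μ := by
    intro t
    conv_rhs => rw [← hinv _ (hg t)]
    rw [integral_map (hmul t).measurable.aemeasurable hW.aestronglyMeasurable]
  simp only [hconst] at key
  have := key.unique (hasDerivAt_const 0 _)
  simpa only [zero_smul, NormedSpace.exp_zero, Matrix.one_mul] using this

lemma integral_schwingerDyson
    (hsupp : μ {A | A ∈ Matrix.specialOrthogonalGroup (Fin (2 * N + 1)) ℝ} = 1)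
    (hinv : ∀ g ∈ Matrix.specialOrthogonalGroup (Fin (2 * N + 1)) ℝ,
      μ.map (fun A => g * A) = μ) {h : Laurent N} (hh : h ∈ B N) (k : ℕ) :
    ∫ A, ψ A (2 * (h * S N k) + E k h) ∂μ = 0 := by
  obtain ⟨F, F', hF⟩ := exists_isLift hh
  have hd : ∀ i j : Fin (2 * N + 1), ∫ A, ((((∑ m ∈ Finset.range k,
      (rot i j * (A ^ m * rot i j * A ^ (k - m))).trace : ℝ) : ℂ) * F A
        + (((rot i j * A ^ k).trace : ℝ) : ℂ) * F' (rot i j) A)) ∂μ = 0 := by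
    intro i j
    have hF1 := hF.continuous
    have hF2 := hF.continuous_deriv (rot i j)
    refine integral_deriv_eq_zero hsupp hinv (rot_transpose i j)
      (W := fun A => (((rot i j * A ^ k).trace : ℝ) : ℂ) * F A) (by fun_prop) (by fun_prop) ?_
    intro A t
    exact (hasDerivAt_trace_mul_pow (rot i j) (rot i j) A k t).ofReal_comp.mul
      (hF.hasDerivAt (rot i j) A t)
  have hsum : ∫ A, ∑ i : Fin (2 * N + 1), ∑ j : Fin (2 * N + 1), ((((∑ m ∈ Finset.range k,
      (rot i j * (A ^ m * rot i j * A ^ (k - m))).trace : ℝ) : ℂ) * F A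
        + (((rot i j * A ^ k).trace : ℝ) : ℂ) * F' (rot i j) A)) ∂μ = 0 := by
    have hF1 := hF.continuous
    have hF2 := hF.continuous_deriv
    have hc : ∀ i j : Fin (2 * N + 1), Continuous fun A : Matrix (Fin (2 * N + 1))
      (Fin (2 * N + 1)) ℝ => ((((∑ m ∈ Finset.range k,
      (rot i j * (A ^ m * rot i j * A ^ (k - m))).trace : ℝ) : ℂ) * F A
        + (((rot i j * A ^ k).trace : ℝ) : ℂ) * F' (rot i j) A)) := fun i j => by fun_prop
    rw [integral_finsetSum _ fun i _ => integrable_of_continuous hsupp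
      (continuous_finsetSum _ fun j _ => hc i j)]
    refine Finset.sum_eq_zero fun i _ => ?_
    rw [integral_finsetSum _ fun j _ => integrable_of_continuous hsupp (hc i j)]
    exact Finset.sum_eq_zero fun j _ => hd i j
  rw [← neg_eq_zero, ← integral_neg, ← hsum]
  refine integral_congr_ae ((ae_mem_SO hsupp).mono fun A hA => ?_)
  beta_reduce
  simp only [Finset.sum_add_distrib]
  rw [hF.sum_eq k A hA]
  simp only [← Finset.sum_mul, ← Complex.ofReal_sum]
  have : ∑ i : Fin (2 * N + 1), ∑ j : Fin (2 * N + 1), ∑ m ∈ Finset.range k,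
      (rot i j * (A ^ m * rot i j * A ^ (k - m))).trace
      = ∑ m ∈ Finset.range k, 2 * (((A ^ m)ᵀ * A ^ (k - m)).trace
        - (A ^ m).trace * (A ^ (k - m)).trace) := by
    simp only [← sum_trace_rot_mul_rot_mul]
    rw [Finset.sum_comm]
    conv_lhs => enter [2, j]; rw [Finset.sum_comm]
    rw [Finset.sum_comm]
    exact Finset.sum_congr rfl fun m _ => Finset.sum_comm
  rw [this, hF.eq A hA, map_add, S, Complex.ofReal_sum]
  simp only [map_mul, map_sum, map_sub, map_ofNat]
  have h2 : ∀ m ∈ Finset.range k, ((2 * (((A ^ m)ᵀ * A ^ (k - m)).trace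
        - (A ^ m).trace * (A ^ (k - m)).trace) : ℝ) : ℂ)
      = -2 * (ψ A (p m) * ψ A (p (k - m)) - ψ A (p (k - 2 * m))) := by
    intro m hm
    have hm' := (Finset.mem_range.1 hm).le
    have h3 : ((k - m : ℕ) : ℤ) - m = k - 2 * m := by omega
    rw [Complex.ofReal_mul, Complex.ofReal_sub, ofReal_trace_transpose_pow_mul_pow hA,
      Complex.ofReal_mul, ← ψ_p hA, ← ψ_p hA, h3, Nat.cast_sub hm']
    push_cast
    ring
  rw [Finset.sum_congr rfl h2, ← Finset.mul_sum]
  ring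

lemma integrable_ψ (hsupp : μ {A | A ∈ Matrix.specialOrthogonalGroup (Fin (2 * N + 1)) ℝ} = 1)
    {f : Laurent N} (hf : f ∈ B N) : Integrable (fun A => ψ A f) μ := by
  obtain ⟨F, F', hF⟩ := exists_isLift hf
  exact (integrable_of_continuous hsupp hF.continuous).congr
    ((ae_mem_SO hsupp).mono fun A hA => hF.eq A hA)

lemma S_mem_B (k : ℕ) : S N k ∈ B N :=
  sum_mem fun _ _ => sub_mem (mul_mem (p_mem_B _) (p_mem_B _)) (p_mem_B _)

lemma E_mem_B (k : ℕ) {h : Laurent N} (hh : h ∈ B N) : E k h ∈ B N := by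
  refine Algebra.adjoin_induction (fun x hx => ?_) (fun r => ?_) (fun f g _ _ hf hg => ?_)
    (fun f g hf' hg' hf hg => ?_) hh
  · obtain ⟨l, rfl⟩ := hx
    simp only [E_p]
    exact Subalgebra.smul_mem _ (sub_mem (p_mem_B _) (p_mem_B _)) _
  · rw [E_algebraMap]
    exact zero_mem _
  · rw [E_add]
    exact add_mem hf hg
  · rw [E_mul]
    exact add_mem (mul_mem hf hg') (mul_mem hf' hg)

/-- The Weyl integration formula, in the form of a coefficient extraction. -/
theorem integral_ψ (hsupp : μ {A | A ∈ Matrix.specialOrthogonalGroup (Fin (2 * N + 1)) ℝ} = 1)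
    (hinv : ∀ g ∈ Matrix.specialOrthogonalGroup (Fin (2 * N + 1)) ℝ,
      μ.map (fun A => g * A) = μ) {f : Laurent N} (hf : f ∈ B N) :
    ∫ A, ψ A f ∂μ = (δ * f).coeff (ρ N) := by
  let K : Submodule ℂ (Laurent N) :=
    { carrier := {f | f ∈ B N ∧ ∫ A, ψ A f ∂μ = 0}
      zero_mem' := ⟨zero_mem _, by simp⟩
      add_mem' := by
        rintro f g ⟨hf, hf'⟩ ⟨hg, hg'⟩
        refine ⟨add_mem hf hg, ?_⟩
        simp only [map_add]
        rw [integral_add (integrable_ψ hsupp hf) (integrable_ψ hsupp hg), hf', hg', add_zero]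
      smul_mem' := by
        rintro r f ⟨hf, hf'⟩
        refine ⟨Subalgebra.smul_mem _ hf r, ?_⟩
        simp only [map_smul]
        rw [integral_smul, hf', smul_zero] }
  have h := (sub_coeff_mem K (fun f hf => hf.1) (fun h hh k => ⟨?_, ?_⟩) f hf).2
  · simp only [map_sub, AlgHom.commutes] at h
    rw [integral_sub (integrable_ψ hsupp hf) (integrable_const _), integral_const, sub_eq_zero] at h
    simpa using h
  · refine add_mem (mul_mem ?_ (mul_mem hh (S_mem_B k))) (E_mem_B k hh)
    exact_mod_cast natCast_mem (B N) 2
  · exact integral_schwingerDyson hsupp hinv hh k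

end Haar

section SumDet

variable {R : Type*} [CommRing R]

lemma det_succ_eq_sub {m : ℕ} (M : Matrix (Fin (m + 1)) (Fin (m + 1)) R) :
    M.det = M 0 0 * (M.submatrix Fin.succ Fin.succ).det
      - ∑ a : Fin m, ((M.submatrix Fin.succ Fin.succ).updateRow a
          fun b => M a.succ 0 * M 0 b.succ).det := by
  rw [det_succ_column_zero, Fin.sum_univ_succ, sub_eq_add_neg, ← Finset.sum_neg_distrib]
  congr 1
  · simp
  · refine Finset.sum_congr rfl fun a _ => ?_
    have h1 : (M.submatrix a.succ.succAbove Fin.succ)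
        = ((M.submatrix Fin.succ Fin.succ).updateRow a fun b => M 0 b.succ).submatrix
          a.cycleRange.symm id := by
      ext c b
      rcases m with _ | m
      · exact a.elim0
      refine Fin.cases ?_ (fun c => ?_) c
      · rw [submatrix_apply, submatrix_apply, Fin.cycleRange_symm_zero, updateRow_self,
          Fin.succ_succAbove_zero]
        rfl
      · rw [submatrix_apply, submatrix_apply, Fin.cycleRange_symm_succ,
          updateRow_ne (Fin.succAbove_ne a c), Fin.succ_succAbove_succ]
        rfl
    have h2 : (fun b : Fin m => M a.succ 0 * M 0 b.succ) = M a.succ 0 • fun b => M 0 b.succ := rfl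
    rw [h1, det_permute, h2, det_updateRow_smul, Equiv.Perm.sign_symm, Fin.sign_cycleRange,
      Fin.val_succ]
    push_cast
    have h3 : ((-1 : R) ^ (a : ℕ)) * (-1) ^ (a : ℕ) = 1 := by
      rw [← mul_pow, neg_one_mul, neg_neg, one_pow]
    linear_combination (-(M a.succ 0) * ((M.submatrix Fin.succ Fin.succ).updateRow a
      fun b => M 0 b.succ).det) * h3

variable {n : Type*} [Fintype n]

/-- The sum over all tuples of indices of the determinants of `(Mₐ (iₐ, i_b))_{a, b}`. -/
def sumDet {m : ℕ} (M : Fin m → Matrix n n R) : R :=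
  ∑ i : Fin m → n, (Matrix.of fun a b => M a (i a) (i b)).det

lemma sumDet_cons {m : ℕ} (M₀ : Matrix n n R) (M : Fin m → Matrix n n R) :
    sumDet (Fin.cons M₀ M) = M₀.trace * sumDet M
      - ∑ a, sumDet (Function.update M a (M a * M₀)) := by
  have h1 : ∀ (a : Fin m) (i : Fin m → n),
      (Matrix.of fun c b => Function.update M a (M a * M₀) c (i c) (i b)).det
        = ∑ i₀, ((Matrix.of fun c b => M c (i c) (i b)).updateRow a
            fun b => M a (i a) i₀ * M₀ i₀ (i b)).det := by
    intro a i
    have : (Matrix.of fun c b => Function.update M a (M a * M₀) c (i c) (i b))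
        = (Matrix.of fun c b => M c (i c) (i b)).updateRow a
            (∑ i₀, fun b => M a (i a) i₀ * M₀ i₀ (i b)) := by
      ext c b
      rcases eq_or_ne c a with rfl | hc
      · rw [of_apply, Function.update_self, updateRow_self, Matrix.mul_apply, Finset.sum_apply]
      · rw [of_apply, Function.update_of_ne hc, updateRow_ne hc, of_apply]
    rw [this]
    exact map_sum (detRowAlternating.toMultilinearMap.toLinearMap
      (Matrix.of fun c b => M c (i c) (i b)) a) _ _
  simp only [sumDet, h1]
  rw [← (Fin.consEquiv fun _ => n).sum_comp, Fintype.sum_prod_type]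
  simp only [det_succ_eq_sub (Matrix.of _), Finset.sum_sub_distrib]
  congr 1
  · rw [Matrix.trace, Finset.sum_mul_sum]
    rfl
  · simp only [Finset.sum_comm (s := (Finset.univ : Finset n))]
    rw [Finset.sum_comm]
    rfl

lemma sumDet_one (A : Matrix n n R) : sumDet ![A] = A.trace := by
  have := sumDet_cons A ![]
  rw [Finset.univ_eq_empty, Finset.sum_empty, sub_zero] at this
  refine this.trans ?_
  simp [sumDet]

lemma sumDet_two (A B : Matrix n n R) :
    sumDet ![A, B] = A.trace * B.trace - (B * A).trace := by
  have := sumDet_cons A ![B]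
  rw [Fin.sum_univ_one] at this
  refine this.trans ?_
  have h : Function.update ![B] 0 (![B] 0 * A) = ![B * A] := by
    ext i; fin_cases i; rfl
  rw [h, sumDet_one, sumDet_one]

lemma sumDet_three (A B C : Matrix n n R) :
    sumDet ![A, B, C] = A.trace * sumDet ![B, C] - sumDet ![B * A, C] - sumDet ![B, C * A] := by
  have := sumDet_cons A ![B, C]
  rw [Fin.sum_univ_two] at this
  refine this.trans ?_
  have h0 : Function.update ![B, C] 0 (![B, C] 0 * A) = ![B * A, C] := by
    ext i; fin_cases i <;> rfl
  have h1 : Function.update ![B, C] 1 (![B, C] 1 * A) = ![B, C * A] := by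
    ext i; fin_cases i <;> rfl
  rw [h0, h1]
  ring

lemma sumDet_four (A B C D : Matrix n n R) :
    sumDet ![A, B, C, D] = A.trace * sumDet ![B, C, D] - sumDet ![B * A, C, D]
      - sumDet ![B, C * A, D] - sumDet ![B, C, D * A] := by
  have := sumDet_cons A ![B, C, D]
  rw [Fin.sum_univ_three] at this
  refine this.trans ?_
  have h0 : Function.update ![B, C, D] 0 (![B, C, D] 0 * A) = ![B * A, C, D] := by
    ext i; fin_cases i <;> rfl
  have h1 : Function.update ![B, C, D] 1 (![B, C, D] 1 * A) = ![B, C * A, D] := by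
    ext i; fin_cases i <;> rfl
  have h2 : Function.update ![B, C, D] 2 (![B, C, D] 2 * A) = ![B, C, D * A] := by
    ext i; fin_cases i <;> rfl
  rw [h0, h1, h2]
  ring

end SumDet

section Moments

variable {N : ℕ}

/-- The linear statistic of a one-variable Laurent polynomial. -/
def F (N : ℕ) (f : AddMonoidAlgebra ℂ ℤ) : Laurent N := ∑ i, ι i f

open Classical in
/-- The sum over distinct variables of the products of one-variable Laurent polynomials. -/
def U (N : ℕ) {m : ℕ} (g : Fin m → AddMonoidAlgebra ℂ ℤ) : Laurent N :=
  ∑ i : Fin m → Fin N, if Function.Injective i then ∏ a, ι (i a) (g a) else 0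

lemma F_mul_U {m : ℕ} (f : AddMonoidAlgebra ℂ ℤ) (g : Fin m → AddMonoidAlgebra ℂ ℤ) :
    F N f * U N g = U N (Fin.cons f g) + ∑ a, U N (Function.update g a (f * g a)) := by
  classical
  have h1 : ∀ i : Fin m → Fin N, Function.Injective i →
      F N f * ∏ a, ι (i a) (g a)
        = (∑ i₀, if i₀ ∉ Set.range i then ι i₀ f * ∏ a, ι (i a) (g a) else 0)
          + ∑ a, ∏ b, ι (i b) (Function.update g a (f * g a) b) := by
    intro i hi
    have h2 : ∀ a, ∏ b, ι (i b) (Function.update g a (f * g a) b)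
        = ι (i a) f * ∏ b, ι (i b) (g b) := by
      intro a
      rw [← Finset.mul_prod_erase _ _ (Finset.mem_univ a),
        ← Finset.mul_prod_erase _ (fun b => ι (i b) (g b)) (Finset.mem_univ a),
        Function.update_self, map_mul, mul_assoc]
      congr 2
      exact Finset.prod_congr rfl fun b hb => by
        rw [Function.update_of_ne (Finset.ne_of_mem_erase hb)]
    simp only [h2, ← Finset.sum_mul]
    rw [← Finset.sum_filter, ← Finset.sum_mul, ← add_mul, F]
    congr 1
    rw [← Finset.sum_filter_add_sum_filter_not _ (fun i₀ => i₀ ∉ Set.range i)]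
    congr 1
    rw [← Finset.sum_image (f := fun i₀ => ι i₀ f) (s := Finset.univ) (g := i) hi.injOn]
    refine Finset.sum_congr ?_ fun _ _ => rfl
    ext i₀
    simp
  rw [U, U, ← (Fin.consEquiv fun _ => Fin N).sum_comp, Fintype.sum_prod_type_right,
    Finset.mul_sum]
  simp only [U]
  conv_rhs => arg 2; rw [Finset.sum_comm]
  rw [← Finset.sum_add_distrib]
  refine Finset.sum_congr rfl fun i _ => ?_
  by_cases hi : Function.Injective i
  · rw [if_pos hi, h1 i hi]
    simp only [if_pos hi]
    congr 1
    refine Finset.sum_congr rfl fun i₀ _ => ?_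
    simp only [Fin.consEquiv, Equiv.coe_fn_mk, Fin.cons_injective_iff, hi, and_true,
      Fin.prod_univ_succ, Fin.cons_zero, Fin.cons_succ]
  · simp only [if_neg hi, mul_zero, Finset.sum_const_zero, add_zero]
    refine (Finset.sum_eq_zero fun i₀ _ => if_neg fun h => hi ?_).symm
    exact (Fin.cons_injective_iff.1 h).2

/-- The matrix of multiplication by `g` on the odd functions `φ (2j + 1)`, truncated. -/
def mulMatrix (N : ℕ) (g : AddMonoidAlgebra ℂ ℤ) : Matrix (Fin N) (Fin N) ℂ :=
  Matrix.of fun i j => (g * φ (2 * (j : ℤ) + 1)).coeff (2 * (i : ℤ) + 1)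

lemma mulMatrix_one : mulMatrix N 1 = 1 := by
  ext i j
  simp only [mulMatrix, one_mul, Matrix.of_apply, Matrix.one_apply, coeff_φ, Fin.ext_iff]
  split_ifs <;> first | omega | simp

lemma mulMatrix_add (f g : AddMonoidAlgebra ℂ ℤ) :
    mulMatrix N (f + g) = mulMatrix N f + mulMatrix N g := by
  ext i j
  simp [mulMatrix, add_mul]

/-- The expectation of a class function, as the coefficient of the Weyl vector. -/
def C (f : Laurent N) : ℂ := (δ * f).coeff (ρ N)

lemma C_add (f g : Laurent N) : C (f + g) = C f + C g := by
  simp [C, mul_add]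

lemma C_sum {κ : Type*} (t : Finset κ) (f : κ → Laurent N) :
    C (∑ x ∈ t, f x) = ∑ x ∈ t, C (f x) := by
  simp [C, Finset.mul_sum, AddMonoidAlgebra.coeff_sum]

lemma C_prod_ι {m : ℕ} {i : Fin m → Fin N} (hi : Function.Injective i)
    (g : Fin m → AddMonoidAlgebra ℂ ℤ) :
    C (∏ a, ι (i a) (g a)) = (Matrix.of fun a b => mulMatrix N (g a) (i a) (i b)).det := by
  have h1 : ∏ a, ι (i a) (g a) = ∏ r, ι r (Function.extend i g 1 r) := by
    rw [← Finset.prod_subset (Finset.subset_univ (Finset.univ.image i)),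
      Finset.prod_image hi.injOn]
    · exact Finset.prod_congr rfl fun a _ => by rw [hi.extend_apply]
    · intro r _ hr
      rw [Function.extend_apply', Pi.one_apply, map_one]
      rintro ⟨a, rfl⟩
      exact hr (Finset.mem_image_of_mem i (Finset.mem_univ a))
  rw [h1, C, coeff_δ_mul]
  have h2 : (Matrix.of fun r s : Fin N => (Function.extend i g 1 r * φ (2 * (s : ℤ) + 1)).coeff
        (2 * (r : ℤ) + 1))
      = 1 + (Matrix.of fun r a => if r = i a then (1 : ℂ) else 0) *
        (Matrix.of fun a s => mulMatrix N (g a) (i a) s - if i a = s then 1 else 0) := by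
    ext r s
    rw [Matrix.add_apply, Matrix.mul_apply, Matrix.of_apply]
    simp only [Matrix.of_apply, ite_mul, one_mul, zero_mul]
    by_cases hr : ∃ a, i a = r
    · obtain ⟨a, rfl⟩ := hr
      simp only [hi.extend_apply, hi.eq_iff, Finset.sum_ite_eq, Finset.mem_univ, if_true,
        Matrix.one_apply]
      rw [add_sub_cancel]
      rfl
    · rw [Function.extend_apply' _ _ _ hr, Finset.sum_eq_zero, add_zero, ← mulMatrix_one]
      · rfl
      · exact fun a _ => if_neg fun h => hr ⟨a, h.symm⟩
  rw [h2, det_one_add_mul_comm]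
  congr 1
  ext a b
  rw [Matrix.add_apply, Matrix.mul_apply]
  simp only [Matrix.of_apply, mul_ite, mul_one, mul_zero, Finset.sum_ite_eq', Finset.mem_univ,
    if_true, Matrix.one_apply, hi.eq_iff]
  ring

lemma C_U {m : ℕ} (g : Fin m → AddMonoidAlgebra ℂ ℤ) :
    C (U N g) = sumDet fun a => mulMatrix N (g a) := by
  classical
  rw [U, C_sum, sumDet]
  refine Finset.sum_congr rfl fun i _ => ?_
  by_cases hi : Function.Injective i
  · rw [if_pos hi, C_prod_ι hi]
  · rw [if_neg hi]
    obtain ⟨a, b, hab, hne⟩ := Function.not_injective_iff.1 hi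
    rw [← det_transpose, det_zero_of_row_eq hne]
    · simp [C]
    · ext c
      simp only [transpose_apply, Matrix.of_apply, hab]

end Moments

section Cumulants

variable {N : ℕ}

lemma U_nil (g : Fin 0 → AddMonoidAlgebra ℂ ℤ) : U N g = 1 := by
  classical
  rw [U, Fintype.sum_subsingleton _ ![], if_pos (Function.injective_of_subsingleton _)]
  simp

lemma F_eq_U (f : AddMonoidAlgebra ℂ ℤ) : F N f = U N ![f] := by
  have := F_mul_U (N := N) f ![]
  rw [U_nil, Finset.univ_eq_empty, Finset.sum_empty, add_zero, mul_one] at this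
  exact this

lemma F_mul_U_one (f g : AddMonoidAlgebra ℂ ℤ) :
    F N f * U N ![g] = U N ![f, g] + U N ![f * g] := by
  have := F_mul_U (N := N) f ![g]
  rw [Fin.sum_univ_one] at this
  refine this.trans ?_
  have h : Function.update ![g] 0 (f * ![g] 0) = ![f * g] := by
    ext1 i; fin_cases i; rfl
  rw [h]
  rfl

lemma F_mul_U_two (f g h : AddMonoidAlgebra ℂ ℤ) :
    F N f * U N ![g, h] = U N ![f, g, h] + U N ![f * g, h] + U N ![g, f * h] := by
  have := F_mul_U (N := N) f ![g, h]
  rw [Fin.sum_univ_two] at this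
  refine this.trans ?_
  have h0 : Function.update ![g, h] 0 (f * ![g, h] 0) = ![f * g, h] := by
    ext1 i; fin_cases i <;> rfl
  have h1 : Function.update ![g, h] 1 (f * ![g, h] 1) = ![g, f * h] := by
    ext1 i; fin_cases i <;> rfl
  rw [h0, h1, add_assoc]
  rfl

lemma F_mul_U_three (f g h k : AddMonoidAlgebra ℂ ℤ) :
    F N f * U N ![g, h, k] = U N ![f, g, h, k] + U N ![f * g, h, k] + U N ![g, f * h, k]
      + U N ![g, h, f * k] := by
  have := F_mul_U (N := N) f ![g, h, k]
  rw [Fin.sum_univ_three] at this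
  refine this.trans ?_
  have h0 : Function.update ![g, h, k] 0 (f * ![g, h, k] 0) = ![f * g, h, k] := by
    ext1 i; fin_cases i <;> rfl
  have h1 : Function.update ![g, h, k] 1 (f * ![g, h, k] 1) = ![g, f * h, k] := by
    ext1 i; fin_cases i <;> rfl
  have h2 : Function.update ![g, h, k] 2 (f * ![g, h, k] 2) = ![g, h, f * k] := by
    ext1 i; fin_cases i <;> rfl
  rw [h0, h1, h2]
  simp only [← add_assoc]
  rfl

lemma sumDet_three_eq {R n : Type*} [CommRing R] [Fintype n] (A B D : Matrix n n R) :
    sumDet ![A, B, D] = A.trace * B.trace * D.trace - A.trace * (B * D).trace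
      - B.trace * (A * D).trace - D.trace * (A * B).trace + (A * B * D).trace
      + (A * D * B).trace := by
  rw [sumDet_three, sumDet_two, sumDet_two, sumDet_two, trace_mul_comm D B, trace_mul_comm B A,
    trace_mul_comm D A, ← Matrix.mul_assoc D B A, trace_mul_cycle D B A, trace_mul_comm (D * A) B,
    ← Matrix.mul_assoc B D A, trace_mul_cycle B D A]
  ring

lemma sumDet_four_eq {R n : Type*} [CommRing R] [Fintype n] (A B : Matrix n n R) :
    sumDet ![A, A, B, B] = A.trace ^ 2 * B.trace ^ 2 - A.trace ^ 2 * (B * B).trace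
      - B.trace ^ 2 * (A * A).trace - 4 * A.trace * B.trace * (A * B).trace
      + (A * A).trace * (B * B).trace + 2 * (A * B).trace ^ 2 + 4 * A.trace * (A * B * B).trace
      + 4 * B.trace * (B * A * A).trace - 4 * (A * A * B * B).trace
      - 2 * (A * B * A * B).trace := by
  have h1 : (B * A * B).trace = (A * B * B).trace := by rw [trace_mul_comm, ← Matrix.mul_assoc,
    trace_mul_comm, ← Matrix.mul_assoc]
  have h2 : (A * A * B).trace = (B * A * A).trace := by rw [trace_mul_comm, ← Matrix.mul_assoc]
  have h3 : (B * B * A).trace = (A * B * B).trace := by rw [trace_mul_comm, ← Matrix.mul_assoc]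
  have h4 : (A * B * B * A).trace = (A * A * B * B).trace := by
    rw [trace_mul_comm, ← Matrix.mul_assoc, ← Matrix.mul_assoc]
  have h7 : (B * A).trace = (A * B).trace := trace_mul_comm B A
  have h8 : (A * B * A).trace = (B * A * A).trace := by rw [trace_mul_comm, ← Matrix.mul_assoc, h2]
  rw [sumDet_four]
  simp only [sumDet_three_eq, ← Matrix.mul_assoc, h1, h2, h3, h4, h7, h8]
  ring

/-- The first cumulant of `F f`. -/
def κ₁ (N : ℕ) (f : AddMonoidAlgebra ℂ ℤ) : ℂ := (mulMatrix N f).trace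

/-- The joint cumulant of `F f` and `F g`. -/
def κ₂ (N : ℕ) (f g : AddMonoidAlgebra ℂ ℤ) : ℂ :=
  (mulMatrix N (f * g)).trace - (mulMatrix N f * mulMatrix N g).trace

/-- The joint cumulant of `F f`, `F g` and `F g`. -/
def κ₃ (N : ℕ) (f g : AddMonoidAlgebra ℂ ℤ) : ℂ :=
  (mulMatrix N (f * (g * g))).trace - (mulMatrix N f * mulMatrix N (g * g)).trace
    - 2 * (mulMatrix N g * mulMatrix N (f * g)).trace
    + 2 * (mulMatrix N f * mulMatrix N g * mulMatrix N g).trace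

/-- The joint cumulant of `F f`, `F f`, `F g` and `F g`. -/
def κ₄ (N : ℕ) (f g : AddMonoidAlgebra ℂ ℤ) : ℂ :=
  (mulMatrix N (f * f * (g * g))).trace - (mulMatrix N (f * f) * mulMatrix N (g * g)).trace
    - 2 * (mulMatrix N (f * g) * mulMatrix N (f * g)).trace
    - 2 * (mulMatrix N f * mulMatrix N (f * (g * g))).trace
    - 2 * (mulMatrix N g * mulMatrix N (g * (f * f))).trace
    + 2 * (mulMatrix N (f * f) * mulMatrix N g * mulMatrix N g).trace
    + 2 * (mulMatrix N (g * g) * mulMatrix N f * mulMatrix N f).trace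
    + 4 * (mulMatrix N (f * g) * mulMatrix N f * mulMatrix N g).trace
    + 4 * (mulMatrix N (f * g) * mulMatrix N g * mulMatrix N f).trace
    - 4 * (mulMatrix N f * mulMatrix N f * mulMatrix N g * mulMatrix N g).trace
    - 2 * (mulMatrix N f * mulMatrix N g * mulMatrix N f * mulMatrix N g).trace

lemma C_U_one (f : AddMonoidAlgebra ℂ ℤ) : C (U N ![f]) = sumDet ![mulMatrix N f] := by
  rw [C_U]
  congr 1
  ext1 i; fin_cases i; rfl

lemma C_U_two (f g : AddMonoidAlgebra ℂ ℤ) :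
    C (U N ![f, g]) = sumDet ![mulMatrix N f, mulMatrix N g] := by
  rw [C_U]
  congr 1
  ext1 i; fin_cases i <;> rfl

lemma C_U_three (f g h : AddMonoidAlgebra ℂ ℤ) :
    C (U N ![f, g, h]) = sumDet ![mulMatrix N f, mulMatrix N g, mulMatrix N h] := by
  rw [C_U]
  congr 1
  ext1 i; fin_cases i <;> rfl

lemma C_U_four (f g h k : AddMonoidAlgebra ℂ ℤ) : C (U N ![f, g, h, k])
    = sumDet ![mulMatrix N f, mulMatrix N g, mulMatrix N h, mulMatrix N k] := by
  rw [C_U]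
  congr 1
  ext1 i; fin_cases i <;> rfl

lemma C_F_sq (f : AddMonoidAlgebra ℂ ℤ) : C (F N f * F N f) = κ₂ N f f + κ₁ N f ^ 2 := by
  nth_rewrite 2 [F_eq_U]
  rw [F_mul_U_one, C_add, C_U_two, C_U_one, sumDet_one, sumDet_two, κ₁, κ₂]
  ring

lemma C_F_sq_mul_F_sq (f g : AddMonoidAlgebra ℂ ℤ) :
    C (F N f * F N f * (F N g * F N g)) - C (F N f * F N f) * C (F N g * F N g)
      = κ₄ N f g + 2 * κ₁ N f * κ₃ N f g + 2 * κ₁ N g * κ₃ N g f + 2 * κ₂ N f g ^ 2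
        + 4 * κ₁ N f * κ₁ N g * κ₂ N f g := by
  have hgf : g * f = f * g := mul_comm g f
  have h3 : f * (f * g) = g * (f * f) := by ring
  have h4 : f * (f * (g * g)) = f * f * (g * g) := by ring
  have hgg : F N g * F N g = U N ![g, g] + U N ![g * g] := by
    nth_rewrite 2 [F_eq_U]
    exact F_mul_U_one g g
  rw [C_F_sq, C_F_sq, hgg]
  simp only [mul_assoc (F N f), mul_add, F_mul_U_one, F_mul_U_two, F_mul_U_three, C_add, C_U_one,
    C_U_two, C_U_three, C_U_four, sumDet_one, sumDet_two, sumDet_three_eq, sumDet_four_eq, κ₁, κ₂,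
    κ₃, κ₄, h3, h4, hgf]
  generalize mulMatrix N f = A
  generalize mulMatrix N g = B
  generalize mulMatrix N (f * g) = AB
  generalize mulMatrix N (f * f) = AA
  generalize mulMatrix N (g * g) = BB
  generalize mulMatrix N (f * (g * g)) = ABB
  generalize mulMatrix N (g * (f * f)) = BAA
  rw [trace_mul_comm ABB A, trace_mul_comm BB AA, trace_mul_comm BAA B]
  have e1 : (A * AB * B).trace = (AB * B * A).trace := (trace_mul_cycle AB B A).symm
  have e2 : (A * B * AB).trace = (AB * A * B).trace := trace_mul_cycle A B AB
  have e3 : (A * A * BB).trace = (BB * A * A).trace := trace_mul_cycle A A BB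
  have e4 : (A * BB * A).trace = (BB * A * A).trace := (trace_mul_cycle BB A A).symm
  linear_combination 2 * A.trace * trace_mul_comm B AB + 2 * B.trace * trace_mul_comm B AA + 4 * e1
    + 4 * e2 + e3 + e4

end Cumulants

section Toeplitz

variable {N : ℕ}

/-- The symmetric Laurent polynomial `X ^ (2k) + X ^ (-2k)`. -/
def γ (k : ℤ) : AddMonoidAlgebra ℂ ℤ :=
  AddMonoidAlgebra.single (2 * k) 1 + AddMonoidAlgebra.single (-(2 * k)) 1

lemma γ_mul (k l : ℤ) : γ k * γ l = γ (k + l) + γ (k - l) := by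
  simp only [γ, add_mul, mul_add, AddMonoidAlgebra.single_mul_single, mul_one]
  rw [show 2 * k + -(2 * l) = 2 * (k - l) by ring, show -(2 * k) + 2 * l = -(2 * (k - l)) by ring,
    show 2 * k + 2 * l = 2 * (k + l) by ring, show -(2 * k) + -(2 * l) = -(2 * (k + l)) by ring]
  abel

lemma mulMatrix_γ (k : ℤ) (i j : Fin N) : mulMatrix N (γ k) i j
    = ((if (i : ℤ) - j = k then 1 else 0) - if (i : ℤ) + j + 1 = k then 1 else 0)
      + ((if (i : ℤ) - j = -k then 1 else 0) - if (i : ℤ) + j + 1 = -k then 1 else 0) := by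
  rw [mulMatrix, Matrix.of_apply, γ, add_mul, AddMonoidAlgebra.coeff_add, Finsupp.add_apply,
    AddMonoidAlgebra.coeff_single_mul_apply, AddMonoidAlgebra.coeff_single_mul_apply, coeff_φ,
    coeff_φ, one_mul, one_mul]
  congr 1 <;> congr 1 <;> exact if_congr (by omega) rfl rfl

/-- The truncated translation by `a`. -/
def shift (n : ℕ) (a : ℤ) : Matrix (Fin n) (Fin n) ℂ :=
  Matrix.of fun x z => if (x : ℤ) = z + a then 1 else 0

/-- The translation by `d`, restricted to the paths staying within the truncation. -/
def window (n : ℕ) (lo hi d : ℤ) : Matrix (Fin n) (Fin n) ℂ :=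
  Matrix.of fun x z => if (x : ℤ) = z + d ∧ 0 ≤ z + lo ∧ z + hi < n then 1 else 0

lemma shift_mul_window (n : ℕ) (a lo hi d : ℤ) (h1 : lo ≤ d) (h2 : d ≤ hi) :
    shift n a * window n lo hi d = window n (min lo (a + d)) (max hi (a + d)) (a + d) := by
  ext x z
  rw [Matrix.mul_apply]
  simp only [shift, window, Matrix.of_apply, ← ite_and, ite_mul, one_mul, zero_mul]
  by_cases h : (x : ℤ) = z + (a + d) ∧ 0 ≤ z + min lo (a + d) ∧ z + max hi (a + d) < n
  · rw [if_pos h, Finset.sum_eq_single ⟨((z : ℤ) + d).toNat, by omega⟩]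
    · exact if_pos (by simp only; omega)
    · intro y _ hy
      refine if_neg fun hc => hy ?_
      ext
      simp only
      omega
    · simp
  · rw [if_neg h]
    refine Finset.sum_eq_zero fun y _ => if_neg fun hc => h ?_
    omega

/-- The reversal matrix. -/
def reversal (n : ℕ) : Matrix (Fin n) (Fin n) ℂ :=
  Matrix.of fun x z => if (x : ℤ) + z + 1 = n then 1 else 0

lemma trace_window (n : ℕ) (lo hi d : ℤ) (hlo : lo ≤ 0) (hhi : 0 ≤ hi) :
    (window n lo hi d).trace = if d = 0 then ((max ((n : ℤ) - (hi - lo)) 0 : ℤ) : ℂ) else 0 := by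
  split_ifs with hd
  · subst hd
    simp only [Matrix.trace, Matrix.diag_apply, window, Matrix.of_apply, add_zero, true_and]
    rw [Finset.sum_boole]
    have : (Finset.univ.filter fun x : Fin n => 0 ≤ (x : ℤ) + lo ∧ (x : ℤ) + hi < n).card
        = (Finset.Ico (-lo) (n - hi)).card := by
      refine Finset.card_bij (fun x _ => (x : ℤ)) (fun x hx => ?_) (fun x _ y _ hxy => ?_)
        fun m hm => ?_
      · rw [Finset.mem_filter] at hx
        rw [Finset.mem_Ico]
        omega
      · ext
        simpa only [Nat.cast_inj] using hxy
      · rw [Finset.mem_Ico] at hm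
        refine ⟨⟨m.toNat, by omega⟩, ?_, ?_⟩
        · rw [Finset.mem_filter]
          exact ⟨Finset.mem_univ _, by simp only; omega, by simp only; omega⟩
        · simp only
          omega
    rw [this, Int.card_Ico, ← Int.cast_natCast, Int.toNat_eq_max]
    congr 2
    ring
  · refine Finset.sum_eq_zero fun x _ => ?_
    rw [Matrix.diag_apply, window, Matrix.of_apply, if_neg]
    omega

lemma trace_window_mul_reversal (N : ℕ) (lo hi d : ℤ) (hlo : lo ≤ 0) (hhi : 0 ≤ hi) :
    (window (2 * N) lo hi d * reversal (2 * N)).trace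
      = if Odd d ∧ d - 2 * lo < 2 * N ∧ 2 * hi - d < 2 * N then 1 else 0 := by
  simp only [Matrix.trace, Matrix.diag_apply, Matrix.mul_apply, window, reversal, Matrix.of_apply,
    ite_mul, one_mul, zero_mul, ← ite_and]
  split_ifs with h
  · obtain ⟨⟨m, rfl⟩, h1, h2⟩ := h
    rw [Finset.sum_eq_single ⟨((N : ℤ) + m).toNat, by omega⟩,
      Finset.sum_eq_single ⟨((N : ℤ) - 1 - m).toNat, by omega⟩]
    · exact if_pos (by push_cast; omega)
    · intro y _ hy
      refine if_neg fun hc => hy ?_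
      ext
      simp only
      push_cast at hc
      omega
    · simp
    · intro y _ hy
      refine Finset.sum_eq_zero fun z _ => if_neg fun hc => hy ?_
      ext
      simp only
      push_cast at hc
      omega
    · simp
  · refine Finset.sum_eq_zero fun x _ => Finset.sum_eq_zero fun z _ => if_neg fun hc => h ?_
    push_cast at hc
    exact ⟨⟨(x : ℤ) - N, by omega⟩, by omega, by omega⟩

/-- The embedding of the odd functions into the functions on the truncation. -/
def oddEmb (N : ℕ) : Matrix (Fin (2 * N)) (Fin N) ℂ :=
  Matrix.of fun x j => (if (x : ℤ) = N + j then 1 else 0) - if (x : ℤ) + j + 1 = N then 1 else 0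

lemma shift_mul_oddEmb (a : ℤ) (x : Fin (2 * N)) (j : Fin N) : (shift (2 * N) a * oddEmb N) x j
    = (if (x : ℤ) = N + j + a then 1 else 0) - if (x : ℤ) + j + 1 = N + a then 1 else 0 := by
  simp only [Matrix.mul_apply, shift, oddEmb, Matrix.of_apply, mul_sub, ite_mul, one_mul, zero_mul,
    Finset.sum_sub_distrib, ← ite_and]
  congr 1
  · split_ifs with h
    · rw [Finset.sum_eq_single ⟨N + j, by omega⟩]
      · exact if_pos (by push_cast; omega)
      · intro y _ hy
        refine if_neg fun hc => hy ?_
        ext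
        simp only
        omega
      · simp
    · exact Finset.sum_eq_zero fun y _ => if_neg (by omega)
  · split_ifs with h
    · rw [Finset.sum_eq_single ⟨N - 1 - j, by omega⟩]
      · exact if_pos (by simp only; omega)
      · intro y _ hy
        refine if_neg fun hc => hy ?_
        ext
        simp only
        omega
      · simp
    · exact Finset.sum_eq_zero fun y _ => if_neg (by omega)

lemma oddEmb_mul {m : Type*} (M : Matrix (Fin N) m ℂ) (x : Fin (2 * N)) (j : m) :
    (oddEmb N * M) x j = if h : N ≤ x then M ⟨x - N, by omega⟩ j
      else -M ⟨N - 1 - x, by omega⟩ j := by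
  simp only [Matrix.mul_apply, oddEmb, Matrix.of_apply, sub_mul, ite_mul, one_mul, zero_mul,
    Finset.sum_sub_distrib]
  split_ifs with h
  · rw [Finset.sum_eq_single ⟨x - N, by omega⟩, if_pos (by simp only; omega), Finset.sum_eq_zero,
      sub_zero]
    · exact fun y _ => if_neg (by omega)
    · intro y _ hy
      refine if_neg fun hc => hy ?_
      ext
      simp only
      omega
    · simp
  · rw [Finset.sum_eq_zero, Finset.sum_eq_single ⟨N - 1 - x, by omega⟩,
      if_pos (by simp only; omega), zero_sub]
    · intro y _ hy
      refine if_neg fun hc => hy ?_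
      ext
      simp only
      omega
    · simp
    · exact fun y _ => if_neg (by omega)

/-- The truncated multiplication by `γ k`. -/
def toeplitz (n : ℕ) (k : ℤ) : Matrix (Fin n) (Fin n) ℂ := shift n k + shift n (-k)

lemma toeplitz_mul_oddEmb (k : ℤ) :
    toeplitz (2 * N) k * oddEmb N = oddEmb N * mulMatrix N (γ k) := by
  ext x j
  rw [toeplitz, Matrix.add_mul, Matrix.add_apply, shift_mul_oddEmb, shift_mul_oddEmb, oddEmb_mul]
  by_cases h : N ≤ x
  · rw [dif_pos h, mulMatrix_γ]
    congr 1 <;> congr 1 <;> refine if_congr ?_ rfl rfl <;> simp only <;> omega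
  · rw [dif_neg h, mulMatrix_γ, neg_add, neg_sub, neg_sub, add_comm]
    congr 1 <;> congr 1 <;> refine if_congr ?_ rfl rfl <;> simp only <;> omega

lemma oddEmb_transpose_mul : (oddEmb N)ᵀ * oddEmb N = 2 := by
  ext i j
  have : (2 : Matrix (Fin N) (Fin N) ℂ) i j = if i = j then 2 else 0 := by
    rw [← Matrix.diagonal_ofNat', Matrix.diagonal_apply]
    rfl
  rw [this, Matrix.mul_apply, Finset.sum_eq_add ⟨N + i, by omega⟩ ⟨N - 1 - i, by omega⟩]
  · simp only [oddEmb, Matrix.transpose_apply, Matrix.of_apply, Fin.ext_iff]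
    split_ifs <;> first | omega | norm_num
  · simp only [ne_eq, Fin.ext_iff]
    omega
  · intro x _ hx
    simp only [ne_eq, Fin.ext_iff] at hx
    rw [Matrix.transpose_apply, oddEmb, Matrix.of_apply, if_neg (by omega), if_neg (by omega),
      sub_zero, zero_mul]
  · simp
  · simp

lemma oddEmb_mul_transpose : oddEmb N * (oddEmb N)ᵀ = 1 - reversal (2 * N) := by
  ext x z
  rw [oddEmb_mul, Matrix.sub_apply, Matrix.one_apply]
  simp only [Matrix.transpose_apply, reversal, Matrix.of_apply, oddEmb, Fin.ext_iff]
  split_ifs <;> first | omega | norm_num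

end Toeplitz

section Paths

variable {N : ℕ}

lemma two_mul_trace {A : Matrix (Fin N) (Fin N) ℂ} {B : Matrix (Fin (2 * N)) (Fin (2 * N)) ℂ}
    (h : B * oddEmb N = oddEmb N * A) :
    2 * A.trace = B.trace - (B * reversal (2 * N)).trace := by
  have h1 : ((oddEmb N)ᵀ * oddEmb N * A).trace = 2 * A.trace := by
    rw [oddEmb_transpose_mul, two_mul, Matrix.trace_add, two_mul]
  rw [← h1, Matrix.mul_assoc, ← h, ← Matrix.mul_assoc, trace_mul_comm, ← Matrix.mul_assoc,
    oddEmb_mul_transpose, Matrix.sub_mul, Matrix.one_mul, Matrix.trace_sub,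
    trace_mul_comm (reversal _)]

/-- The lowest point of the path with the given steps. -/
def low : List ℤ → ℤ
  | [] => 0
  | a :: l => min (low l) (a + l.sum)

/-- The highest point of the path with the given steps. -/
def high : List ℤ → ℤ
  | [] => 0
  | a :: l => max (high l) (a + l.sum)

lemma low_le (l : List ℤ) : low l ≤ 0 ∧ low l ≤ l.sum := by
  cases l with
  | nil => simp [low]
  | cons a l =>
    have := (low_le l).1
    rw [low, List.sum_cons]
    omega

lemma le_high (l : List ℤ) : 0 ≤ high l ∧ l.sum ≤ high l := by
  cases l with
  | nil => simp [high]
  | cons a l =>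
    have := (le_high l).1
    rw [high, List.sum_cons]
    omega

lemma sum_map_neg (l : List ℤ) : (l.map fun a => -a).sum = -l.sum := by
  induction l with
  | nil => rfl
  | cons a l ih => rw [List.map_cons, List.sum_cons, List.sum_cons, ih]; ring

lemma low_map_neg (l : List ℤ) : low (l.map fun a => -a) = -high l := by
  induction l with
  | nil => simp [low, high]
  | cons a l ih => rw [List.map_cons, low, high, ih, sum_map_neg]; omega

lemma high_map_neg (l : List ℤ) : high (l.map fun a => -a) = -low l := by
  induction l with
  | nil => simp [low, high]
  | cons a l ih => rw [List.map_cons, low, high, ih, sum_map_neg]; omega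

lemma prod_shift (n : ℕ) (l : List ℤ) :
    (l.map (shift n)).prod = window n (low l) (high l) l.sum := by
  induction l with
  | nil =>
    ext x z
    rw [List.map_nil, List.prod_nil, Matrix.one_apply, window, Matrix.of_apply, low, high,
      List.sum_nil]
    exact if_congr (by rw [Fin.ext_iff]; omega) rfl rfl
  | cons a l ih =>
    rw [List.map_cons, List.prod_cons, ih, shift_mul_window _ _ _ _ _ (low_le l).2 (le_high l).2,
      low, high, List.sum_cons]

/-- The contribution of a path to the traces. -/
def path (N : ℕ) (l : List ℤ) : ℤ :=
  (if l.sum = 0 then max (2 * (N : ℤ) - (high l - low l)) 0 else 0)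
    - if l.sum % 2 = 1 ∧ l.sum - 2 * low l < 2 * N ∧ 2 * high l - l.sum < 2 * N then 1 else 0

lemma path_map_neg (l : List ℤ) : path N (l.map fun a => -a) = path N l := by
  rw [path, path, low_map_neg, high_map_neg, sum_map_neg]
  congr 1 <;> refine if_congr (by omega) ?_ rfl
  · congr 1
    ring
  · rfl

/-- The trace over the functions which are odd under the reversal, doubled. -/
def oddTrace (N : ℕ) (B : Matrix (Fin (2 * N)) (Fin (2 * N)) ℂ) : ℂ :=
  B.trace - (B * reversal (2 * N)).trace

lemma oddTrace_add (A B : Matrix (Fin (2 * N)) (Fin (2 * N)) ℂ) :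
    oddTrace N (A + B) = oddTrace N A + oddTrace N B := by
  rw [oddTrace, oddTrace, oddTrace, Matrix.add_mul, Matrix.trace_add, Matrix.trace_add]
  ring

lemma oddTrace_prod (l : List ℤ) : oddTrace N (l.map (shift (2 * N))).prod = path N l := by
  rw [prod_shift, oddTrace, trace_window _ _ _ _ (low_le l).1 (le_high l).1,
    trace_window_mul_reversal _ _ _ _ (low_le l).1 (le_high l).1, path]
  simp only [Int.odd_iff]
  push_cast
  rfl

lemma trace_one (a : ℤ) : (mulMatrix N (γ a)).trace = path N [a] := by
  have h := two_mul_trace (toeplitz_mul_oddEmb (N := N) a)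
  have h0 : ∀ a, oddTrace N (shift (2 * N) a) = path N [a] := fun a => by
    rw [← oddTrace_prod]; simp
  change _ = oddTrace N (toeplitz (2 * N) a) at h
  have h1 : path N [-a] = path N [a] := path_map_neg [a]
  rw [toeplitz, oddTrace_add, h0, h0, h1] at h
  linear_combination h / 2

lemma trace_two (a b : ℤ) : (mulMatrix N (γ a) * mulMatrix N (γ b)).trace
    = path N [a, b] + path N [a, -b] := by
  have h := two_mul_trace (N := N) (A := mulMatrix N (γ a) * mulMatrix N (γ b))
    (B := toeplitz (2 * N) a * toeplitz (2 * N) b) (by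
      simp only [Matrix.mul_assoc, toeplitz_mul_oddEmb]
      simp only [← Matrix.mul_assoc, toeplitz_mul_oddEmb])
  have h0 : ∀ a b, oddTrace N (shift (2 * N) a * shift (2 * N) b) = path N [a, b] := fun a b => by
    rw [← oddTrace_prod]; simp
  have h1 : path N [-a, b] = path N [a, -b] := by simpa using path_map_neg (N := N) [a, -b]
  have h2 : path N [-a, -b] = path N [a, b] := path_map_neg [a, b]
  change _ = oddTrace N (toeplitz (2 * N) a * toeplitz (2 * N) b) at h
  simp only [toeplitz, Matrix.add_mul, Matrix.mul_add, oddTrace_add, h0, h1, h2] at h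
  linear_combination h / 2

lemma trace_three (a b c : ℤ) :
    (mulMatrix N (γ a) * mulMatrix N (γ b) * mulMatrix N (γ c)).trace
      = path N [a, b, c] + path N [a, b, -c] + path N [a, -b, c] + path N [a, -b, -c] := by
  have h := two_mul_trace (N := N)
    (A := mulMatrix N (γ a) * mulMatrix N (γ b) * mulMatrix N (γ c))
    (B := toeplitz (2 * N) a * toeplitz (2 * N) b * toeplitz (2 * N) c) (by
      simp only [Matrix.mul_assoc, toeplitz_mul_oddEmb]
      simp only [← Matrix.mul_assoc, toeplitz_mul_oddEmb])
  have h0 : ∀ a b c, oddTrace N (shift (2 * N) a * shift (2 * N) b * shift (2 * N) c)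
      = path N [a, b, c] := fun a b c => by
    rw [← oddTrace_prod]; simp [Matrix.mul_assoc]
  have h1 : ∀ b c, path N [-a, b, c] = path N [a, -b, -c] := fun b c => by
    simpa using path_map_neg (N := N) [a, -b, -c]
  change _ = oddTrace N (toeplitz (2 * N) a * toeplitz (2 * N) b * toeplitz (2 * N) c) at h
  simp only [toeplitz, Matrix.add_mul, Matrix.mul_add, oddTrace_add, h0, h1, neg_neg] at h
  linear_combination h / 2

lemma trace_four (a b c d : ℤ) :
    (mulMatrix N (γ a) * mulMatrix N (γ b) * mulMatrix N (γ c) * mulMatrix N (γ d)).trace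
      = path N [a, b, c, d] + path N [a, b, c, -d] + path N [a, b, -c, d] + path N [a, b, -c, -d]
        + path N [a, -b, c, d] + path N [a, -b, c, -d] + path N [a, -b, -c, d]
        + path N [a, -b, -c, -d] := by
  have h := two_mul_trace (N := N)
    (A := mulMatrix N (γ a) * mulMatrix N (γ b) * mulMatrix N (γ c) * mulMatrix N (γ d))
    (B := toeplitz (2 * N) a * toeplitz (2 * N) b * toeplitz (2 * N) c * toeplitz (2 * N) d) (by
      simp only [Matrix.mul_assoc, toeplitz_mul_oddEmb]
      simp only [← Matrix.mul_assoc, toeplitz_mul_oddEmb])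
  have h0 : ∀ a b c d, oddTrace N
      (shift (2 * N) a * shift (2 * N) b * shift (2 * N) c * shift (2 * N) d)
      = path N [a, b, c, d] := fun a b c d => by
    rw [← oddTrace_prod]; simp [Matrix.mul_assoc]
  have h1 : ∀ b c d, path N [-a, b, c, d] = path N [a, -b, -c, -d] := fun b c d => by
    simpa using path_map_neg (N := N) [a, -b, -c, -d]
  change _ = oddTrace N
    (toeplitz (2 * N) a * toeplitz (2 * N) b * toeplitz (2 * N) c * toeplitz (2 * N) d) at h
  simp only [toeplitz, Matrix.add_mul, Matrix.mul_add, oddTrace_add, h0, h1, neg_neg] at h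
  linear_combination h / 2

end Paths

section Values

variable {N : ℕ}

/-- The number of translates by steps of total length `x` staying within the truncation. -/
def room (N : ℕ) (x : ℤ) : ℤ := max (2 * (N : ℤ) - x) 0

lemma path_of_sum_eq_zero {l : List ℤ} (x : ℤ) (h : l.sum = 0) (hx : high l - low l = x) :
    path N l = room N x := by
  rw [path, if_pos h, if_neg (by omega), sub_zero, hx, room]

lemma path_of_even {l : List ℤ} (h : l.sum ≠ 0) (h2 : l.sum % 2 = 0) : path N l = 0 := by
  rw [path, if_neg h, if_neg (by omega), sub_zero]

lemma path_of_odd {l : List ℤ} (h2 : l.sum % 2 = 1) :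
    path N l = -if l.sum - 2 * low l < 2 * N ∧ 2 * high l - l.sum < 2 * N then 1 else 0 := by
  rw [path, if_neg (by omega), zero_sub]
  simp only [h2, true_and]

lemma trace_one_of_even {a : ℤ} (h : a % 2 = 0) :
    (mulMatrix N (γ a)).trace = if a = 0 then (room N 0 : ℂ) else 0 := by
  rw [trace_one]
  split_ifs with h0
  · rw [path_of_sum_eq_zero 0] <;> simp [high, low, h0]
  · rw [path_of_even] <;> simp [h0, h]

lemma trace_two_of_even {a b : ℤ} (h : (a + b) % 2 = 0) :
    (mulMatrix N (γ a) * mulMatrix N (γ b)).trace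
      = (if a + b = 0 then (room N |a| : ℂ) else 0)
        + if a - b = 0 then (room N |a| : ℂ) else 0 := by
  have h0 : ∀ b : ℤ, (a + b) % 2 = 0 →
      (path N [a, b] : ℂ) = if a + b = 0 then (room N |a| : ℂ) else 0 := by
    intro b h
    split_ifs with h0
    · rw [path_of_sum_eq_zero |a|] <;>
        simp only [high, low, List.sum_cons, List.sum_nil, abs_eq_max_neg] <;> omega
    · rw [path_of_even, Int.cast_zero] <;> simp only [List.sum_cons, List.sum_nil] <;> omega
  rw [trace_two, h0 _ h, h0 _ (by omega)]
  simp only [← sub_eq_add_neg]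

lemma trace_three_of_even {a b c : ℤ} (h : (a + b + c) % 2 = 0) :
    (mulMatrix N (γ a) * mulMatrix N (γ b) * mulMatrix N (γ c)).trace
      = (if a + b + c = 0 then (room N (max |a| (max |b| |c|)) : ℂ) else 0)
        + (if a + b - c = 0 then (room N (max |a| (max |b| |c|)) : ℂ) else 0)
        + (if a - b + c = 0 then (room N (max |a| (max |b| |c|)) : ℂ) else 0)
        + if a - b - c = 0 then (room N (max |a| (max |b| |c|)) : ℂ) else 0 := by
  have h0 : ∀ b c : ℤ, (a + b + c) % 2 = 0 → (path N [a, b, c] : ℂ)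
      = if a + b + c = 0 then (room N (max |a| (max |b| |c|)) : ℂ) else 0 := by
    intro b c h
    split_ifs with h0
    · rw [path_of_sum_eq_zero (max |a| (max |b| |c|))] <;>
        simp only [high, low, List.sum_cons, List.sum_nil, abs_eq_max_neg] <;> omega
    · rw [path_of_even, Int.cast_zero] <;> simp only [List.sum_cons, List.sum_nil] <;> omega
  rw [trace_three, h0 _ _ h, h0 _ _ (by omega), h0 _ _ (by omega), h0 _ _ (by omega)]
  simp only [← sub_eq_add_neg, abs_neg]

lemma path_four_of_ne {a b c d : ℤ} (h : a + b + c + d ≠ 0) (h2 : (a + b + c + d) % 2 = 0) :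
    path N [a, b, c, d] = 0 :=
  path_of_even (by simp only [List.sum_cons, List.sum_nil]; omega)
    (by simp only [List.sum_cons, List.sum_nil]; omega)

lemma trace_four_comm {k l : ℤ} (hk : 0 < k) (hl : 0 < l) (h : k ≠ l) :
    (mulMatrix N (γ k) * mulMatrix N (γ k) * mulMatrix N (γ l) * mulMatrix N (γ l)).trace
      = (room N (max k l) + room N (k + l) : ℂ) := by
  have h1 : path N [k, -k, l, -l] = room N (max k l) :=
    path_of_sum_eq_zero _ (by simp) (by simp only [high, low, List.sum_cons, List.sum_nil]; omega)
  have h2 : path N [k, -k, -l, l] = room N (k + l) :=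
    path_of_sum_eq_zero _ (by simp) (by simp only [high, low, List.sum_cons, List.sum_nil]; omega)
  rw [trace_four, h1, h2, path_four_of_ne (by omega) (by omega),
    path_four_of_ne (by omega) (by omega), path_four_of_ne (by omega) (by omega),
    path_four_of_ne (by omega) (by omega), path_four_of_ne (by omega) (by omega),
    path_four_of_ne (by omega) (by omega)]
  push_cast
  ring

lemma trace_four_alternate {k l : ℤ} (hk : 0 < k) (hl : 0 < l) (h : k ≠ l) :
    (mulMatrix N (γ k) * mulMatrix N (γ l) * mulMatrix N (γ k) * mulMatrix N (γ l)).trace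
      = (2 * room N (k + l) : ℂ) := by
  have h1 : path N [k, l, -k, -l] = room N (k + l) :=
    path_of_sum_eq_zero _ (by simp) (by simp only [high, low, List.sum_cons, List.sum_nil]; omega)
  have h2 : path N [k, -l, -k, l] = room N (k + l) :=
    path_of_sum_eq_zero _ (by simp) (by simp only [high, low, List.sum_cons, List.sum_nil]; omega)
  rw [trace_four, h1, h2, path_four_of_ne (by omega) (by omega),
    path_four_of_ne (by omega) (by omega), path_four_of_ne (by omega) (by omega),
    path_four_of_ne (by omega) (by omega), path_four_of_ne (by omega) (by omega),
    path_four_of_ne (by omega) (by omega)]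
  push_cast
  ring

lemma trace_four_self {k : ℤ} (hk : 0 < k) :
    (mulMatrix N (γ k) * mulMatrix N (γ k) * mulMatrix N (γ k) * mulMatrix N (γ k)).trace
      = (room N k + 2 * room N (2 * k) : ℂ) := by
  have h1 : path N [k, -k, k, -k] = room N k :=
    path_of_sum_eq_zero _ (by simp) (by simp only [high, low, List.sum_cons, List.sum_nil]; omega)
  have h2 : path N [k, -k, -k, k] = room N (2 * k) :=
    path_of_sum_eq_zero _ (by simp) (by simp only [high, low, List.sum_cons, List.sum_nil]; omega)
  have h3 : path N [k, k, -k, -k] = room N (2 * k) :=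
    path_of_sum_eq_zero _ (by simp) (by simp only [high, low, List.sum_cons, List.sum_nil]; omega)
  rw [trace_four, h1, h2, h3, path_four_of_ne (by omega) (by omega),
    path_four_of_ne (by omega) (by omega), path_four_of_ne (by omega) (by omega),
    path_four_of_ne (by omega) (by omega), path_four_of_ne (by omega) (by omega)]
  push_cast
  ring

lemma κ₄_γ_of_lt {k l : ℤ} (hk : 0 < k) (h : k < l) : κ₄ N (γ k) (γ l)
    = (4 * room N l - 2 * room N (k + l) - 2 * room N (l - k) : ℂ) := by
  have e1 : (mulMatrix N (γ k * γ k * (γ l * γ l))).trace = (2 * room N 0 : ℂ) := by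
    simp only [γ_mul, mul_add, add_mul, mulMatrix_add, Matrix.trace_add]
    simp (disch := omega) only [trace_one_of_even, if_pos, if_neg]
    ring
  have e2 : (mulMatrix N (γ k * γ k) * mulMatrix N (γ l * γ l)).trace = (2 * room N 0 : ℂ) := by
    simp only [γ_mul, mulMatrix_add, Matrix.add_mul, Matrix.mul_add, Matrix.trace_add]
    simp (disch := omega) only [trace_two_of_even, if_pos, if_neg]
    simp only [sub_self, abs_zero]
    ring
  have e3 : (mulMatrix N (γ k * γ l) * mulMatrix N (γ k * γ l)).trace
      = (room N (k + l) + room N (l - k) : ℂ) := by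
    simp only [γ_mul, mulMatrix_add, Matrix.add_mul, Matrix.mul_add, Matrix.trace_add]
    simp (disch := omega) only [trace_two_of_even, if_pos, if_neg, abs_of_nonneg, abs_of_nonpos]
    rw [neg_sub]
    ring
  have e4 : (mulMatrix N (γ k) * mulMatrix N (γ k * (γ l * γ l))).trace
      = (2 * room N k : ℂ) := by
    simp only [γ_mul, mul_add, mulMatrix_add, Matrix.trace_add]
    simp (disch := omega) only [trace_two_of_even, if_pos, if_neg, abs_of_nonneg]
    ring
  have e5 : (mulMatrix N (γ l) * mulMatrix N (γ l * (γ k * γ k))).trace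
      = (2 * room N l : ℂ) := by
    simp only [γ_mul, mul_add, mulMatrix_add, Matrix.trace_add]
    simp (disch := omega) only [trace_two_of_even, if_pos, if_neg, abs_of_nonneg]
    ring
  have e6 : (mulMatrix N (γ k * γ k) * mulMatrix N (γ l) * mulMatrix N (γ l)).trace
      = (2 * room N l : ℂ) := by
    simp only [γ_mul, mulMatrix_add, Matrix.add_mul, Matrix.trace_add]
    simp (disch := omega) only [trace_three_of_even, if_pos, if_neg, abs_of_nonneg,
      max_eq_left, max_eq_right]
    ring
  have e7 : (mulMatrix N (γ l * γ l) * mulMatrix N (γ k) * mulMatrix N (γ k)).trace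
      = (2 * room N k : ℂ) := by
    simp only [γ_mul, mulMatrix_add, Matrix.add_mul, Matrix.trace_add]
    simp (disch := omega) only [trace_three_of_even, if_pos, if_neg, abs_of_nonneg,
      max_eq_left, max_eq_right]
    ring
  have e8 : (mulMatrix N (γ k * γ l) * mulMatrix N (γ k) * mulMatrix N (γ l)).trace
      = (room N (k + l) + room N l : ℂ) := by
    simp only [γ_mul, mulMatrix_add, Matrix.add_mul, Matrix.trace_add]
    simp (disch := omega) only [trace_three_of_even, if_pos, if_neg, abs_of_nonneg, abs_of_nonpos,
      max_eq_left, max_eq_right]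
    ring
  have e9 : (mulMatrix N (γ k * γ l) * mulMatrix N (γ l) * mulMatrix N (γ k)).trace
      = (room N (k + l) + room N l : ℂ) := by
    simp only [γ_mul, mulMatrix_add, Matrix.add_mul, Matrix.trace_add]
    simp (disch := omega) only [trace_three_of_even, if_pos, if_neg, abs_of_nonneg, abs_of_nonpos,
      max_eq_left, max_eq_right]
    ring
  rw [κ₄, e1, e2, e3, e4, e5, e6, e7, e8, e9, trace_four_comm hk (by omega) h.ne,
    trace_four_alternate hk (by omega) h.ne, max_eq_right h.le]
  ring

lemma κ₄_γ_self {k : ℤ} (hk : 0 < k) : κ₄ N (γ k) (γ k)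
    = (6 * room N k - 3 * room N 0 - 3 * room N (2 * k) : ℂ) := by
  have e1 : (mulMatrix N (γ k * γ k * (γ k * γ k))).trace = (3 * room N 0 : ℂ) := by
    simp only [γ_mul, mul_add, add_mul, mulMatrix_add, Matrix.trace_add]
    simp (disch := omega) only [trace_one_of_even, if_pos, if_neg]
    ring
  have e2 : (mulMatrix N (γ k * γ k) * mulMatrix N (γ k * γ k)).trace
      = (room N (2 * k) + 2 * room N 0 : ℂ) := by
    simp only [γ_mul, mulMatrix_add, Matrix.add_mul, Matrix.mul_add, Matrix.trace_add]
    simp (disch := omega) only [trace_two_of_even, if_pos, if_neg, abs_of_nonneg]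
    rw [sub_self, two_mul k]
    ring
  have e3 : (mulMatrix N (γ k) * mulMatrix N (γ k * (γ k * γ k))).trace
      = (3 * room N k : ℂ) := by
    simp only [γ_mul, mul_add, mulMatrix_add, Matrix.trace_add]
    simp (disch := omega) only [trace_two_of_even, if_pos, if_neg, abs_of_nonneg]
    ring
  have e4 : (mulMatrix N (γ k * γ k) * mulMatrix N (γ k) * mulMatrix N (γ k)).trace
      = (room N (2 * k) + 2 * room N k : ℂ) := by
    simp only [γ_mul, mulMatrix_add, Matrix.add_mul, Matrix.trace_add]
    simp (disch := omega) only [trace_three_of_even, if_pos, if_neg, abs_of_nonneg,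
      max_eq_left, max_eq_right]
    rw [two_mul k]
    ring
  rw [κ₄, e1, e2, e3, e4, trace_four_self hk]
  ring

/-- The indicator of the displacements staying within the truncation. -/
def near (N : ℕ) (a : ℤ) : ℂ := if |a| < 2 * N then 1 else 0

lemma near_mul_near (a b : ℤ) :
    near N a * near N b = if |a| < 2 * N ∧ |b| < 2 * N then 1 else 0 := by
  rw [near, near, ite_and]
  split_ifs <;> simp

lemma near_mul_of_le {a b : ℤ} (h : |a| ≤ |b|) : near N a * near N b = near N b := by
  rw [near_mul_near, near]
  exact if_congr (by omega) rfl rfl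

lemma near_congr {a b : ℤ} (h : |a| = |b|) : near N a = near N b := by
  rw [near, near, h]

lemma near_mul_self (a : ℤ) : near N a * near N a = near N a := near_mul_of_le le_rfl

lemma eps_of_odd {a : ℤ} (h : a % 2 = 1) (ha : 0 < a) : (eps N a : ℂ) = near N a := by
  rw [eps, near, abs_of_pos ha]
  rw [apply_ite Complex.ofReal, Complex.ofReal_one, Complex.ofReal_zero]
  exact if_congr (by rw [Int.odd_iff]; omega) rfl rfl

lemma eps_of_even {a : ℤ} (h : a % 2 = 0) : eps N a = 0 := by
  rw [eps, if_neg]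
  rw [Int.odd_iff]
  omega

lemma trace_one_of_odd {a : ℤ} (h : a % 2 = 1) : (mulMatrix N (γ a)).trace = -near N a := by
  rw [trace_one, path_of_odd (by simpa), near]
  push_cast
  congr 1
  refine if_congr ?_ rfl rfl
  simp only [high, low, List.sum_cons, List.sum_nil, abs_eq_max_neg]
  omega

lemma trace_two_of_odd {a b : ℤ} (h : (a + b) % 2 = 1) :
    (mulMatrix N (γ a) * mulMatrix N (γ b)).trace = -2 * (near N (a + b) * near N (a - b)) := by
  have h0 : ∀ b, (a + b) % 2 = 1 →
      (path N [a, b] : ℂ) = -(near N (a + b) * near N (a - b)) := by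
    intro b h
    rw [path_of_odd (by simpa), near_mul_near]
    push_cast
    congr 1
    refine if_congr ?_ rfl rfl
    simp only [high, low, List.sum_cons, List.sum_nil, abs_eq_max_neg]
    omega
  rw [trace_two, h0 _ h, h0 _ (by omega), sub_neg_eq_add a b, sub_eq_add_neg a b]
  ring

lemma trace_three_of_odd {a b c : ℤ} (h : (a + b + c) % 2 = 1) :
    (mulMatrix N (γ a) * mulMatrix N (γ b) * mulMatrix N (γ c)).trace
      = -(near N (a + b + c) * near N (a + b - c) * near N (a - b - c))
        - near N (a + b - c) * near N (a + b + c) * near N (a - b + c)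
        - near N (a - b + c) * near N (a - b - c) * near N (a + b - c)
        - near N (a - b - c) * near N (a - b + c) * near N (a + b + c) := by
  have h0 : ∀ b c, (a + b + c) % 2 = 1 → (path N [a, b, c] : ℂ)
      = -(near N (a + b + c) * near N (a + b - c) * near N (a - b - c)) := by
    intro b c h
    have h1 : near N (a + b + c) * near N (a + b - c) * near N (a - b - c)
        = if |a + b + c| < 2 * N ∧ |a + b - c| < 2 * N ∧ |a - b - c| < 2 * N then 1 else 0 := by
      rw [near_mul_near, near, ite_and, ite_and, ite_and]
      split_ifs <;> simp
    rw [path_of_odd (by simpa [add_assoc] using h), h1]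
    push_cast
    congr 1
    refine if_congr ?_ rfl rfl
    simp only [high, low, List.sum_cons, List.sum_nil, abs_eq_max_neg]
    omega
  rw [trace_three, h0 _ _ h, h0 _ _ (by omega), h0 _ _ (by omega), h0 _ _ (by omega)]
  simp only [sub_neg_eq_add, ← sub_eq_add_neg]

lemma κ₁_γ {k : ℤ} (hk : 0 < k) : κ₁ N (γ k) = -(eps N k : ℂ) := by
  rw [κ₁]
  rcases Int.emod_two_eq_zero_or_one k with h | h
  · rw [trace_one_of_even h, if_neg hk.ne', eps_of_even h]
    simp
  · rw [trace_one_of_odd h, eps_of_odd h hk]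

lemma κ₂_γ_self {k : ℤ} (hk : 0 < k) : κ₂ N (γ k) (γ k) = ((min k (2 * N) : ℤ) : ℂ) := by
  rw [κ₂, γ_mul, mulMatrix_add, Matrix.trace_add]
  simp (disch := omega) only [trace_one_of_even, trace_two_of_even, if_pos, if_neg, abs_of_nonneg]
  have : (min k (2 * N) : ℤ) = room N 0 - room N k := by
    rw [room, room]
    omega
  rw [this]
  push_cast
  ring

lemma κ₂_γ_of_ne {k l : ℤ} (hk : 0 < k) (hl : 0 < l) (h : k ≠ l) :
    κ₂ N (γ k) (γ l) = eps N (k + l) - eps N |k - l| := by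
  rw [κ₂, γ_mul, mulMatrix_add, Matrix.trace_add]
  rcases Int.emod_two_eq_zero_or_one (k + l) with h2 | h2
  · rw [eps_of_even h2, eps_of_even (by rw [abs_eq_max_neg]; omega)]
    simp (disch := omega) only [trace_one_of_even, trace_two_of_even, if_neg]
    simp
  · rw [eps_of_odd h2 (by omega), eps_of_odd (by rw [abs_eq_max_neg]; omega)
      (abs_pos.2 (by omega)), trace_one_of_odd h2, trace_one_of_odd (by omega),
      trace_two_of_odd h2, mul_comm (near N (k + l)),
      near_mul_of_le (by simp only [abs_eq_max_neg]; omega), near_congr (abs_abs (k - l))]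
    ring

lemma κ₃_γ_of_odd {k l : ℤ} (hk : 0 < k) (hl : 0 < l) (h : k % 2 = 1) :
    κ₃ N (γ k) (γ l)
      = 2 * eps N k * eps N |k - 2 * l| - eps N (k + 2 * l) - eps N |k - 2 * l| := by
  rw [κ₃]
  simp only [γ_mul, mul_add, mulMatrix_add, Matrix.trace_add]
  rw [eps_of_odd h hk, eps_of_odd (by rw [abs_eq_max_neg]; omega) (abs_pos.2 (by omega)),
    eps_of_odd (by omega) (by omega)]
  simp (disch := omega) only [trace_one_of_odd, trace_two_of_odd, trace_three_of_odd]
  rw [near_congr (abs_abs (k - 2 * l))]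
  have n2 : near N (l - (k + l)) = near N k :=
    near_congr (by rw [abs_eq_max_neg, abs_eq_max_neg]; omega)
  have n3 : near N (l - (k - l)) = near N (k - 2 * l) :=
    near_congr (by rw [abs_eq_max_neg, abs_eq_max_neg]; omega)
  have h1 : near N k * near N (k + 2 * l) = near N (k + 2 * l) :=
    near_mul_of_le (by rw [abs_eq_max_neg, abs_eq_max_neg]; omega)
  have h2 : near N (k - 2 * l) * near N (k + 2 * l) = near N (k + 2 * l) :=
    near_mul_of_le (by rw [abs_eq_max_neg, abs_eq_max_neg]; omega)
  rw [n2, n3, show k + (l + l) = k + 2 * l by ring, show k - (l + l) = k - 2 * l by ring,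
    show k + (l - l) = k by ring, show k - (l - l) = k by ring,
    show l + (k + l) = k + 2 * l by ring,
    show l + (k - l) = k by ring, show k + l + l = k + 2 * l by ring, show k + l - l = k by ring,
    show k - l - l = k - 2 * l by ring, show k - l + l = k by ring]
  generalize near N (k + 2 * l) = a at *
  have h3 := near_mul_self (N := N) k
  generalize near N (k - 2 * l) = b at *
  generalize near N k = c at *
  linear_combination (2 - 4 * b - 2 * c) * h1 - 2 * h2 + (2 - 2 * b) * h3

end Values

section Covariance

variable {N : ℕ}

lemma V_of_lt {k l : ℤ} (hk : 0 < k) (h : k < l) :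
    V N k l = ((4 * room N l - 2 * room N (k + l) - 2 * room N (l - k) : ℤ) : ℝ) := by
  have e : ((N : ℤ) : ℝ) = N := Int.cast_natCast N
  have e1 : max ((N : ℝ) - max (k : ℝ) (l : ℝ)) 0 = ((max (N - l) 0 : ℤ) : ℝ) := by
    rw [max_eq_right (a := (k : ℝ)) (by exact_mod_cast h.le)]
    push_cast
    rfl
  have e2 : max (2 * (N : ℝ) - |(k : ℝ) - (l : ℝ)|) 0 = (room N (l - k) : ℝ) := by
    rw [abs_sub_comm, abs_of_pos (by rw [sub_pos]; exact_mod_cast h), room]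
    push_cast
    rfl
  have e3 : max (2 * (N : ℝ) - (k : ℝ) - (l : ℝ)) 0 = (room N (k + l) : ℝ) := by
    rw [room]
    push_cast
    rw [sub_sub]
  rw [V, e1, e2, e3, min_eq_left h.le, max_eq_right h.le]
  simp only [alph]
  have : 4 * max (min k N + min l N - l) 0 + 4 * max (min l N + min (l - k) N - l) 0
      + 4 * max (min k N + min (k - l) N - k) 0
      + 4 * max (min (k + l) N + min l N - (k + l)) 0
      + 4 * max (min (k + l) N + min k N - (k + l)) 0
      - 8 * max (min (k + l) N + min k N - (k + l)) 0
      - 4 * max (min k N + min k N - (k + l)) 0 - 4 * max (min l N + min l N - (k + l)) 0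
      = 4 * room N l - 8 * max (N - l) 0 := by
    unfold room
    omega
  have := congrArg (fun z : ℤ => (z : ℝ)) this
  push_cast at this ⊢
  linarith

lemma V_comm (k l : ℤ) : V N k l = V N l k := by
  rw [V, V, max_comm (l : ℝ), abs_sub_comm (l : ℝ), min_comm l, max_comm l, add_comm l k,
    sub_right_comm _ (l : ℝ)]
  ring

lemma delta_comm (k l : ℤ) : delta N k l = delta N l k := by
  rw [delta, delta, abs_sub_comm l k, min_comm l, max_comm l, add_comm l k]
  ring

lemma delta_of_lt {k l : ℤ} (hk : 0 < k) (h : k < l) : delta N k l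
    = 2 * (eps N (k + 2 * l) - eps N k * eps N |k - 2 * l|)
      + 2 * (eps N (l + 2 * k) - eps N l * eps N |l - 2 * k|)
      + 2 * (eps N |k - l| - eps N (k + l)) := by
  have e1 : eps N k * eps N |k - 2 * l| = eps N (2 * l - k) := by
    rw [abs_sub_comm, abs_of_pos (by omega), eps, eps, ite_zero_mul_ite_zero, mul_one]
    refine if_congr ?_ rfl rfl
    simp only [Int.odd_iff]
    omega
  have e2 : eps N l * eps N |l - 2 * k| = eps N l := by
    rw [eps, eps, ite_zero_mul_ite_zero, mul_one]
    refine if_congr ?_ rfl rfl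
    simp only [Int.odd_iff, abs_eq_max_neg]
    omega
  rw [delta, abs_sub_comm (2 * k), abs_sub_comm (2 * l), min_eq_left h.le, max_eq_right h.le,
    add_comm (2 * k), add_comm (2 * l)]
  linear_combination 8 * e1 + 8 * e2

lemma eps_mul_self (a : ℤ) : eps N a * eps N a = eps N a := by
  rw [eps]
  split_ifs <;> simp

lemma κ₁_mul_κ₃_γ {k l : ℤ} (hk : 0 < k) (hl : 0 < l) :
    κ₁ N (γ k) * κ₃ N (γ k) (γ l)
      = ((eps N (k + 2 * l) - eps N k * eps N |k - 2 * l| : ℝ) : ℂ) := by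
  rw [κ₁_γ hk]
  rcases Int.emod_two_eq_zero_or_one k with h | h
  · rw [eps_of_even h, eps_of_even (a := k + 2 * l) (by omega)]
    simp
  · have e : eps N k * eps N (k + 2 * l) = eps N (k + 2 * l) := by
      rw [eps, eps, ite_zero_mul_ite_zero, mul_one]
      refine if_congr ?_ rfl rfl
      simp only [Int.odd_iff]
      omega
    rw [κ₃_γ_of_odd hk hl h, ← Complex.ofReal_neg]
    norm_cast
    linear_combination -2 * eps N |k - 2 * l| * eps_mul_self (N := N) k + e

lemma κ₂_γ_sq_of_ne {k l : ℤ} (hk : 0 < k) (hl : 0 < l) (h : k ≠ l) :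
    κ₂ N (γ k) (γ l) ^ 2 = ((eps N |k - l| - eps N (k + l) : ℝ) : ℂ) := by
  have e : eps N (k + l) * eps N |k - l| = eps N (k + l) := by
    rw [eps, eps, ite_zero_mul_ite_zero, mul_one]
    refine if_congr ?_ rfl rfl
    simp only [Int.odd_iff, abs_eq_max_neg]
    omega
  rw [κ₂_γ_of_ne hk hl h]
  norm_cast
  linear_combination eps_mul_self (N := N) |k - l| + eps_mul_self (N := N) (k + l) - 2 * e

lemma κ₁_mul_κ₁_mul_κ₂_γ_of_ne {k l : ℤ} (hk : 0 < k) (hl : 0 < l) (h : k ≠ l) :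
    κ₁ N (γ k) * κ₁ N (γ l) * κ₂ N (γ k) (γ l) = 0 := by
  rw [κ₁_γ hk, κ₁_γ hl, κ₂_γ_of_ne hk hl h]
  rcases Int.emod_two_eq_zero_or_one k with h1 | h1
  · simp [eps_of_even h1]
  rcases Int.emod_two_eq_zero_or_one l with h2 | h2
  · simp [eps_of_even h2]
  rw [eps_of_even (a := k + l) (by omega), eps_of_even (a := |k - l|)
    (by rw [abs_eq_max_neg]; omega)]
  simp

lemma covariance_of_lt {k l : ℤ} (hk : 0 < k) (h : k < l) :
    C (F N (γ k) * F N (γ k) * (F N (γ l) * F N (γ l)))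
        - C (F N (γ k) * F N (γ k)) * C (F N (γ l) * F N (γ l))
      = ((V N k l + delta N k l : ℝ) : ℂ) := by
  have hl : 0 < l := hk.trans h
  rw [C_F_sq_mul_F_sq, κ₄_γ_of_lt hk h, mul_assoc 2, κ₁_mul_κ₃_γ hk hl, mul_assoc 2,
    κ₁_mul_κ₃_γ hl hk, κ₂_γ_sq_of_ne hk hl h.ne, mul_assoc 4, mul_assoc 4,
    κ₁_mul_κ₁_mul_κ₂_γ_of_ne hk hl h.ne, V_of_lt hk h, delta_of_lt hk h]
  push_cast
  ring

lemma covariance_of_ne {k l : ℤ} (hk : 0 < k) (hl : 0 < l) (h : k ≠ l) :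
    C (F N (γ k) * F N (γ k) * (F N (γ l) * F N (γ l)))
        - C (F N (γ k) * F N (γ k)) * C (F N (γ l) * F N (γ l))
      = ((V N k l + delta N k l : ℝ) : ℂ) := by
  rcases h.lt_or_gt with h | h
  · exact covariance_of_lt hk h
  · rw [V_comm, delta_comm, ← covariance_of_lt hl h, mul_comm (F N (γ k) * _),
      mul_comm (C (F N (γ k) * _))]

lemma covariance_self {k : ℤ} (hk : 0 < k) :
    C (F N (γ k) * F N (γ k) * (F N (γ k) * F N (γ k)))
        - C (F N (γ k) * F N (γ k)) * C (F N (γ k) * F N (γ k)) = ((T N k : ℝ) : ℂ) := by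
  have e0 : ((6 * room N k - 3 * room N 0 - 3 * room N (2 * k) : ℤ) : ℝ)
      = ((6 * (min k N - min k (2 * N)) : ℤ) : ℝ) := by
    congr 1
    unfold room
    omega
  have e1 : min ((k : ℝ) ^ 2) ((2 * (N : ℝ)) ^ 2) = ((min k (2 * N) : ℤ) : ℝ) ^ 2 := by
    have hk' : (0 : ℝ) ≤ k := by exact_mod_cast hk.le
    have hN' : (0 : ℝ) ≤ 2 * (N : ℝ) := by positivity
    push_cast
    rcases le_total (k : ℝ) (2 * N) with h | h
    · rw [min_eq_left h, min_eq_left (pow_le_pow_left₀ hk' h 2)]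
    · rw [min_eq_right h, min_eq_right (pow_le_pow_left₀ hN' h 2)]
  have e2 : |k - 2 * k| = k := by
    rw [abs_eq_max_neg]
    omega
  have e3 : κ₁ N (γ k) * κ₁ N (γ k) = (eps N k : ℂ) := by
    rw [κ₁_γ hk, neg_mul_neg, ← Complex.ofReal_mul, eps_mul_self]
  rw [C_F_sq_mul_F_sq, κ₄_γ_self hk, mul_assoc 2, κ₁_mul_κ₃_γ hk hk, mul_assoc 4, e3,
    κ₂_γ_self hk, ← Complex.ofReal_intCast (min k (2 * N)), e2, eps_mul_self,
    show k + 2 * k = 3 * k by ring, T, e1]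
  have e0' := congrArg (fun z : ℝ => (z : ℂ)) e0
  push_cast at e0' ⊢
  linear_combination e0'

end Covariance

section Probability

lemma hasSum_variance_tsum {Ω : Type*} [MeasurableSpace Ω] {μ : Measure Ω}
    [IsProbabilityMeasure μ] {Z : ℕ → Ω → ℝ} (hZ : ∀ k, AEStronglyMeasurable (Z k) μ)
    {b : ℕ → ℝ} (hb : Summable b) (hZb : ∀ k, ∀ᵐ ω ∂μ, ‖Z k ω‖ ≤ b k) :
    HasSum (fun p : ℕ × ℕ =>
        ∫ ω, Z p.1 ω * Z p.2 ω ∂μ - (∫ ω, Z p.1 ω ∂μ) * ∫ ω, Z p.2 ω ∂μ)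
      (variance (fun ω => ∑' k, Z k ω) μ) := by
  have hall : ∀ᵐ ω ∂μ, ∀ k, ‖Z k ω‖ ≤ b k := ae_all_iff.2 hZb
  have hb0 : ∀ k, 0 ≤ b k := fun k => by
    obtain ⟨ω, hω⟩ := (hZb k).exists
    exact (norm_nonneg _).trans hω
  have hbb : Summable fun p : ℕ × ℕ => b p.1 * b p.2 :=
    hb.mul_of_nonneg hb hb0 hb0
  have hinteg : ∀ k, Integrable (Z k) μ := fun k => Integrable.of_bound (hZ k) (b k) (hZb k)
  have hnorm : ∀ p : ℕ × ℕ, ∀ᵐ ω ∂μ, ‖Z p.1 ω * Z p.2 ω‖ ≤ b p.1 * b p.2 := fun p =>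
    hall.mono fun ω h => by
      rw [norm_mul]
      exact mul_le_mul (h _) (h _) (norm_nonneg _) (hb0 _)
  have hZZ : ∀ p : ℕ × ℕ, Integrable (fun ω => Z p.1 ω * Z p.2 ω) μ := fun p =>
    Integrable.of_bound ((hZ _).mul (hZ _)) _ (hnorm p)
  have hle : ∀ {f : Ω → ℝ} {c : ℝ}, Integrable f μ → (∀ᵐ ω ∂μ, ‖f ω‖ ≤ c) →
      ∫ ω, ‖f ω‖ ∂μ ≤ c := fun hf h => by
    simpa using integral_mono_ae hf.norm (integrable_const _) h
  have h1 : HasSum (fun k => ∫ ω, Z k ω ∂μ) (∫ ω, ∑' k, Z k ω ∂μ) :=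
    hasSum_integral_of_summable_integral_norm hinteg
      (hb.of_nonneg_of_le (fun k => integral_nonneg fun ω => norm_nonneg _)
        fun k => hle (hinteg k) (hZb k))
  have h2 : HasSum (fun p : ℕ × ℕ => ∫ ω, Z p.1 ω * Z p.2 ω ∂μ)
      (∫ ω, ∑' p : ℕ × ℕ, Z p.1 ω * Z p.2 ω ∂μ) :=
    hasSum_integral_of_summable_integral_norm hZZ
      (hbb.of_nonneg_of_le (fun k => integral_nonneg fun ω => norm_nonneg _)
        fun p => hle (hZZ p) (hnorm p))
  have h3 : Summable fun p : ℕ × ℕ => (∫ ω, Z p.1 ω ∂μ) * ∫ ω, Z p.2 ω ∂μ := by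
    refine Summable.of_norm_bounded hbb fun p => ?_
    rw [norm_mul]
    exact mul_le_mul ((norm_integral_le_integral_norm _).trans (hle (hinteg _) (hZb _)))
      ((norm_integral_le_integral_norm _).trans (hle (hinteg _) (hZb _))) (norm_nonneg _) (hb0 _)
  have hmeas : AEStronglyMeasurable (fun ω => ∑' k, Z k ω) μ := by
    refine aestronglyMeasurable_of_tendsto_ae Filter.atTop
      (f := fun n ω => ∑ k ∈ Finset.range n, Z k ω)
      (fun n => Finset.aestronglyMeasurable_fun_sum _ fun k _ => hZ k) ?_
    exact hall.mono fun ω h => (Summable.of_norm_bounded hb h).hasSum.tendsto_sum_nat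
  have hLp : MemLp (fun ω => ∑' k, Z k ω) 2 μ :=
    MemLp.of_bound hmeas (∑' k, b k) (hall.mono fun ω h => tsum_of_norm_bounded hb.hasSum h)
  have hsq : ∫ ω, ∑' p : ℕ × ℕ, Z p.1 ω * Z p.2 ω ∂μ = ∫ ω, (∑' k, Z k ω) ^ 2 ∂μ := by
    refine integral_congr_ae (hall.mono fun ω h => ?_)
    have hs : Summable fun k => ‖Z k ω‖ := hb.of_nonneg_of_le (fun k => norm_nonneg _) h
    beta_reduce
    rw [sq, tsum_mul_tsum_of_summable_norm hs hs]
  have h4 := h2.sub (h1.mul h1 h3)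
  rw [hsq, ← sq] at h4
  rw [variance_eq_sub hLp]
  exact h4

lemma tsum_prod_eq_add_of_summable {f : ℕ × ℕ → ℝ} (hf : Summable f) :
    ∑' p, f p = (∑' k, f (k, k)) + ∑' p : ℕ × ℕ, if p.1 ≠ p.2 then f p else 0 := by
  have h1 : Summable fun p : ℕ × ℕ => if p.1 = p.2 then f p else 0 :=
    (hf.indicator {p | p.1 = p.2}).congr fun p => by simp [Set.indicator_apply]
  have h2 : Summable fun p : ℕ × ℕ => if p.1 ≠ p.2 then f p else 0 :=
    (hf.indicator {p | p.1 ≠ p.2}).congr fun p => by simp [Set.indicator_apply]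
  have h3 : ∑' k, f (k, k) = ∑' p : ℕ × ℕ, if p.1 = p.2 then f p else 0 := by
    have hi : Function.Injective fun k : ℕ => (k, k) := fun a b h => congrArg Prod.fst h
    rw [← hi.tsum_eq]
    · simp
    · rintro ⟨a, b⟩ h
      have : a = b := by
        by_contra hab
        exact h (if_neg hab)
      exact ⟨a, by rw [this]⟩
  rw [h3, ← h1.tsum_add h2]
  refine tsum_congr fun p => ?_
  by_cases h : p.1 = p.2 <;> simp [h]

variable {N : ℕ}

lemma F_γ (k : ℤ) : F N (γ k) = p k - 1 := by
  rw [p, add_sub_cancel_left, F]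
  refine Finset.sum_congr rfl fun i _ => ?_
  rw [γ, map_add, ι_single, ι_single, c, w, w]

lemma F_γ_mem_B (k : ℤ) : F N (γ k) ∈ B N := by
  rw [F_γ]
  exact sub_mem (p_mem_B k) (one_mem _)

lemma ψ_F_γ {A : Matrix (Fin (2 * N + 1)) (Fin (2 * N + 1)) ℝ}
    (hA : A ∈ Matrix.specialOrthogonalGroup (Fin (2 * N + 1)) ℝ) (k : ℕ) :
    ψ A (F N (γ k)) = (((A ^ k).trace - 1 : ℝ) : ℂ) := by
  rw [F_γ, map_sub, map_one, ψ_p hA]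
  push_cast
  rfl

variable {μ : Measure (Matrix (Fin (2 * N + 1)) (Fin (2 * N + 1)) ℝ)} [IsProbabilityMeasure μ]

lemma integral_trace_sub_one_sq
    (hsupp : μ {A | A ∈ Matrix.specialOrthogonalGroup (Fin (2 * N + 1)) ℝ} = 1)
    (hinv : ∀ g ∈ Matrix.specialOrthogonalGroup (Fin (2 * N + 1)) ℝ,
      μ.map (fun A => g * A) = μ) (k : ℕ) :
    ((∫ A, ((A ^ k).trace - 1) ^ 2 ∂μ : ℝ) : ℂ) = C (F N (γ k) * F N (γ k)) := by
  rw [C, ← integral_ψ hsupp hinv (mul_mem (F_γ_mem_B _) (F_γ_mem_B _)), ← integral_complex_ofReal]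
  refine integral_congr_ae ((ae_mem_SO hsupp).mono fun A hA => ?_)
  beta_reduce
  rw [map_mul, ψ_F_γ hA, ← sq]
  push_cast
  rfl

lemma integral_trace_sub_one_sq_mul
    (hsupp : μ {A | A ∈ Matrix.specialOrthogonalGroup (Fin (2 * N + 1)) ℝ} = 1)
    (hinv : ∀ g ∈ Matrix.specialOrthogonalGroup (Fin (2 * N + 1)) ℝ,
      μ.map (fun A => g * A) = μ) (k l : ℕ) :
    ((∫ A, ((A ^ k).trace - 1) ^ 2 * ((A ^ l).trace - 1) ^ 2 ∂μ : ℝ) : ℂ)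
      = C (F N (γ k) * F N (γ k) * (F N (γ l) * F N (γ l))) := by
  rw [C, ← integral_ψ hsupp hinv (mul_mem (mul_mem (F_γ_mem_B _) (F_γ_mem_B _))
    (mul_mem (F_γ_mem_B _) (F_γ_mem_B _))), ← integral_complex_ofReal]
  refine integral_congr_ae ((ae_mem_SO hsupp).mono fun A hA => ?_)
  beta_reduce
  rw [map_mul, map_mul, map_mul, ψ_F_γ hA, ψ_F_γ hA, ← sq, ← sq]
  push_cast
  rfl

lemma covariance_trace_sub_one_sq
    (hsupp : μ {A | A ∈ Matrix.specialOrthogonalGroup (Fin (2 * N + 1)) ℝ} = 1)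
    (hinv : ∀ g ∈ Matrix.specialOrthogonalGroup (Fin (2 * N + 1)) ℝ,
      μ.map (fun A => g * A) = μ) {k l : ℕ} (hk : 0 < k) (hl : 0 < l) :
    ∫ A, ((A ^ k).trace - 1) ^ 2 * ((A ^ l).trace - 1) ^ 2 ∂μ
        - (∫ A, ((A ^ k).trace - 1) ^ 2 ∂μ) * ∫ A, ((A ^ l).trace - 1) ^ 2 ∂μ
      = if k = l then T N k else V N k l + delta N k l := by
  rw [← Complex.ofReal_inj, Complex.ofReal_sub, Complex.ofReal_mul,
    integral_trace_sub_one_sq_mul hsupp hinv, integral_trace_sub_one_sq hsupp hinv,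
    integral_trace_sub_one_sq hsupp hinv]
  split_ifs with h
  · rw [h, covariance_self (by exact_mod_cast hl)]
  · exact covariance_of_ne (by exact_mod_cast hk) (by exact_mod_cast hl) (by exact_mod_cast h)

lemma hasSum_variance_traceSum
    (hsupp : μ {A | A ∈ Matrix.specialOrthogonalGroup (Fin (2 * N + 1)) ℝ} = 1)
    (hinv : ∀ g ∈ Matrix.specialOrthogonalGroup (Fin (2 * N + 1)) ℝ,
      μ.map (fun A => g * A) = μ) :
    HasSum (fun p : ℕ × ℕ => (if p.1 = p.2 then T N ((p.1 : ℤ) + 1) else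
          V N ((p.1 : ℤ) + 1) ((p.2 : ℤ) + 1) + delta N ((p.1 : ℤ) + 1) ((p.2 : ℤ) + 1))
        / (((p.1 : ℝ) + 1) ^ 2 * ((p.2 : ℝ) + 1) ^ 2))
      (variance (fun A => ∑' k : ℕ, ((A ^ (k + 1)).trace - 1) ^ 2 / ((k : ℝ) + 1) ^ 2) μ) := by
  obtain ⟨M, hM⟩ := exists_bound_SO (N := N)
    (G := fun A => (((A.trace - 1) ^ 2 : ℝ) : ℂ)) (by fun_prop)
  have hb : Summable fun k : ℕ => M / ((k : ℝ) + 1) ^ 2 := by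
    have := ((summable_nat_add_iff 1).2 (Real.summable_one_div_nat_pow.2 one_lt_two)).mul_left M
    refine this.congr fun k => ?_
    push_cast
    ring
  have hmeas : ∀ k : ℕ, AEStronglyMeasurable
      (fun A : Matrix (Fin (2 * N + 1)) (Fin (2 * N + 1)) ℝ =>
        ((A ^ (k + 1)).trace - 1) ^ 2 / ((k : ℝ) + 1) ^ 2) μ := fun k =>
    Continuous.aestronglyMeasurable (by fun_prop)
  have hbound : ∀ k : ℕ, ∀ᵐ A ∂μ, ‖((A ^ (k + 1)).trace - 1) ^ 2 / ((k : ℝ) + 1) ^ 2‖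
      ≤ M / ((k : ℝ) + 1) ^ 2 := fun k => (ae_mem_SO hsupp).mono fun A hA => by
    have := hM _ (pow_mem hA (k + 1))
    rw [Complex.norm_real] at this
    rw [norm_div, Real.norm_of_nonneg (sq_nonneg ((k : ℝ) + 1))]
    gcongr
  refine (hasSum_variance_tsum hmeas hb hbound).congr_fun fun p => ?_
  have key := covariance_trace_sub_one_sq hsupp hinv p.1.succ_pos p.2.succ_pos
  simp only [Nat.succ_eq_add_one, add_left_inj, Nat.cast_add, Nat.cast_one] at key
  rw [← key]
  simp only [div_mul_div_comm, integral_div, sub_div]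

end Probability

end OddOrthogonal

/-- For `A` Haar-distributed on `SO(2N+1)`,
`Var( Σ_{k≥1} (Tr(A^k) − 1)²/k² ) = Σ_{k≥1} T(k)/k⁴ + Σ_{k≠ℓ} (V(k,ℓ) + δ(k,ℓ))/(k²ℓ²)`. -/
theorem variance_traceSum_specialOrthogonal_odd
    (N : ℕ) (hN : 1 ≤ N)
    (μ : Measure (Matrix (Fin (2 * N + 1)) (Fin (2 * N + 1)) ℝ)) [IsProbabilityMeasure μ]
    (hsupp : μ {A | A ∈ Matrix.specialOrthogonalGroup (Fin (2 * N + 1)) ℝ} = 1)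
    (hinv : ∀ g ∈ Matrix.specialOrthogonalGroup (Fin (2 * N + 1)) ℝ,
      μ.map (fun A => g * A) = μ) :
    variance (fun A => ∑' k : ℕ, ((A ^ (k + 1)).trace - 1) ^ 2 / ((k : ℝ) + 1) ^ 2) μ
      = (∑' k : ℕ, T N ((k : ℤ) + 1) / ((k : ℝ) + 1) ^ 4)
        + ∑' p : ℕ × ℕ, if p.1 ≠ p.2 then
            (V N ((p.1 : ℤ) + 1) ((p.2 : ℤ) + 1) + delta N ((p.1 : ℤ) + 1) ((p.2 : ℤ) + 1))
              / (((p.1 : ℝ) + 1) ^ 2 * ((p.2 : ℝ) + 1) ^ 2)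
          else 0 := by
  have h := OddOrthogonal.hasSum_variance_traceSum hsupp hinv
  rw [← h.tsum_eq, OddOrthogonal.tsum_prod_eq_add_of_summable h.summable]
  congr 1
  · refine tsum_congr fun k => ?_
    rw [if_pos rfl, ← pow_add]
  · refine tsum_congr fun p => ?_
    by_cases hp : p.1 = p.2 <;> simp [hp]
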